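/- arXiv:2106.06407 — 2 statements merged into one kernel-verified Lean document; each statement's English description precedes it below -/
import Mathlib

section
/- Let G be an abelian group and let φ : Fans_d → G be a rotation-invariant fan valuation (i.e. φ(g·N) = φ(N) for all rotations g ∈ SO(d) and all fans N). Then there exist elements g_0, …, g_d ∈ G such that for every linear hyperplane arrangement A in a subspace of ℝ^d, φ(Fan(A)) = g_0·w_0(A) + g_1·w_1(A) + ⋯ + g_d·w_d(A), where w_i(A) are the unsigned Whitney numbers of the first kind of A. -/
open scoped Pointwise
open MeasureTheory RealInnerProductSpace

noncomputable section

/-- Euclidean space `ℝ^d`. -/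
abbrev Ed (d : ℕ) : Type := EuclideanSpace ℝ (Fin d)

/-- A polyhedral cone in `ℝ^d`: a (nonempty) finite intersection of closed linear
halfspaces; it automatically contains the origin. -/
def IsPolyCone (d : ℕ) (C : Set (Ed d)) : Prop :=
  ∃ s : Finset (Ed d), C = {x | ∀ c ∈ s, ⟪c, x⟫ ≤ 0}

/-- A face of a cone `C`: the intersection of `C` with a supporting linear hyperplane
(`C` itself being a face, for `c = 0`). -/
def IsFaceOf (d : ℕ) (C F : Set (Ed d)) : Prop :=
  ∃ c : Ed d, (∀ x ∈ C, ⟪c, x⟫ ≤ 0) ∧ F = {x ∈ C | ⟪c, x⟫ = 0}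

/-- Dimension of a subset of `ℝ^d` (dimension of its linear span). -/
def setDim (d : ℕ) (S : Set (Ed d)) : ℕ :=
  Module.finrank ℝ (Submodule.span ℝ S)

/-- Dimension of the lineality space of a cone `C`, i.e. of the maximal linear
subspace `C ∩ (-C)` contained in `C`. -/
def linealDim (d : ℕ) (C : Set (Ed d)) : ℕ :=
  setDim d (C ∩ (-C))

/-- A fan: a finite collection of polyhedral cones, pairwise meeting in common faces,
and all having the same linear span. -/
def IsFan (d : ℕ) (N : Set (Set (Ed d))) : Prop :=
  N.Finite ∧ (∀ C ∈ N, IsPolyCone d C) ∧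
    (∀ C ∈ N, ∀ C' ∈ N, IsFaceOf d C (C ∩ C') ∧ IsFaceOf d C' (C ∩ C')) ∧
    (∀ C ∈ N, ∀ C' ∈ N, Submodule.span ℝ C = Submodule.span ℝ C')

/-- The restriction `N ∩ S` of a fan to a set `S`. -/
def fanInter (d : ℕ) (N : Set (Set (Ed d))) (S : Set (Ed d)) : Set (Set (Ed d)) :=
  {D | ∃ C ∈ N, (intrinsicInterior ℝ C ∩ S).Nonempty ∧ D = C ∩ S}

/-- A fan valuation: `φ ∅ = 0` and `φ(N) = φ(N ∩ H^≤) + φ(N ∩ H^≥) - φ(N ∩ H)`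
for every fan `N` and every linear hyperplane `H` of `lin N` (encoded by a nonzero
normal vector `c ∈ lin N`). -/
def IsFanValuation (d : ℕ) {G : Type*} [AddCommGroup G] (φ : Set (Set (Ed d)) → G) : Prop :=
  φ ∅ = 0 ∧
    ∀ N : Set (Set (Ed d)), IsFan d N →
      ∀ c : Ed d, c ≠ 0 → (∀ C ∈ N, c ∈ Submodule.span ℝ C) →
        φ N = φ (fanInter d N {x | ⟪c, x⟫ ≤ 0}) + φ (fanInter d N {x | 0 ≤ ⟪c, x⟫})
              - φ (fanInter d N {x | ⟪c, x⟫ = 0})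

/-- A rotation of `ℝ^d`: a linear isometry of determinant `1`. -/
def IsRotation (d : ℕ) (g : Ed d ≃ₗᵢ[ℝ] Ed d) : Prop :=
  LinearMap.det (g.toLinearEquiv : Ed d →ₗ[ℝ] Ed d) = 1

/-- The image fan `g · N`. -/
def fanMap (d : ℕ) (g : Ed d ≃ₗᵢ[ℝ] Ed d) (N : Set (Set (Ed d))) : Set (Set (Ed d)) :=
  (fun C => g '' C) '' N

/-- `H` is a linear hyperplane of the subspace `L`. -/
def IsHyperplaneOf (d : ℕ) (H L : Submodule ℝ (Ed d)) : Prop :=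
  H ≤ L ∧ Module.finrank ℝ H + 1 = Module.finrank ℝ L

/-- (The data of) a hyperplane arrangement: an ambient subspace together with a finite
set of subspaces (intended: hyperplanes of the ambient space). -/
structure Arrangement (d : ℕ) where
  space : Submodule ℝ (Ed d)
  hyps : Finset (Submodule ℝ (Ed d))

variable {d : ℕ}

/-- The data are an actual arrangement: each member is a hyperplane of the ambient
subspace. -/
def Arrangement.IsArrangement (A : Arrangement d) : Prop :=
  ∀ H ∈ A.hyps, IsHyperplaneOf d H A.space

/-- A `k`-singleton: an arrangement consisting of a single hyperplane of a
`k`-dimensional subspace. -/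
def Arrangement.IsSingletonArr (A : Arrangement d) (k : ℕ) : Prop :=
  A.IsArrangement ∧ A.hyps.card = 1 ∧ Module.finrank ℝ A.space = k

/-- The complement `L \ ∪ A` of an arrangement in its ambient subspace. -/
def arrComplement (A : Arrangement d) : Set (Ed d) :=
  (A.space : Set (Ed d)) \ ⋃ H ∈ A.hyps, (H : Set (Ed d))

/-- The fan of an arrangement: closures of the connected components of the complement. -/
def arrFan (A : Arrangement d) : Set (Set (Ed d)) :=
  {C | ∃ x ∈ arrComplement A, C = closure (connectedComponentIn (arrComplement A) x)}

/-- Deletion `A ∖ H`. -/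
def Arrangement.delete (A : Arrangement d) (H : Submodule ℝ (Ed d)) : Arrangement d :=
  letI := Classical.decEq (Submodule ℝ (Ed d))
  ⟨A.space, A.hyps.erase H⟩

/-- Restriction `A / H`. -/
def Arrangement.restrict (A : Arrangement d) (H : Submodule ℝ (Ed d)) : Arrangement d :=
  letI := Classical.decEq (Submodule ℝ (Ed d))
  ⟨H, (A.hyps.erase H).image (fun H' => H' ⊓ H)⟩

open Polynomial in
/-- The recursive definition of the unsigned characteristic polynomial:
`χ̄_A(t) = t^k + t^(k-1)` for a `k`-singleton, and
`χ̄_A = χ̄_{A∖H} + χ̄_{A/H}` for `H ∈ A` otherwise.  Its coefficients are the unsigned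
Whitney numbers of the first kind. -/
inductive IsCharPoly (d : ℕ) : Arrangement d → Polynomial ℤ → Prop
  | singleton (A : Arrangement d) (k : ℕ) (hk : 1 ≤ k) (hA : A.IsSingletonArr k) :
      IsCharPoly d A (X ^ k + X ^ (k - 1))
  | deletion_restriction (A : Arrangement d) (H : Submodule ℝ (Ed d)) (hH : H ∈ A.hyps)
      (hcard : 1 < A.hyps.card) (p q : Polynomial ℤ)
      (hp : IsCharPoly d (A.delete H) p) (hq : IsCharPoly d (A.restrict H) q) :
      IsCharPoly d A (p + q)

open Classical in
/-- The metric projection (nearest-point map) of a set `C ⊆ ℝ^d`: the unique nearest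
point when it exists (as it does for nonempty closed convex sets). -/
def metricProj (d : ℕ) (C : Set (Ed d)) (x : Ed d) : Ed d :=
  if h : ∃! y, y ∈ C ∧ ∀ z ∈ C, dist x y ≤ dist x z then h.choose else 0

/-- The normal cone `N_F C` of `C` at a face `F`. -/
def normalCone (d : ℕ) (C F : Set (Ed d)) : Set (Ed d) :=
  {c | ∀ x ∈ C, ∀ y ∈ F, ⟪c, x⟫ ≤ ⟪c, y⟫}

/-- `Π_k(C)`: points `x` whose nearest point of `C` lies in the relative interior of a
`k`-dimensional face of `C`. -/
def Pik (d : ℕ) (C : Set (Ed d)) (k : ℕ) : Set (Ed d) :=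
  {x | ∃ F, IsFaceOf d C F ∧ metricProj d C x ∈ intrinsicInterior ℝ F ∧ setDim d F = k}

/-- The `k`-th spherical intrinsic volume of a cone. -/
def sphIntrinsicVol (d : ℕ) (C : Set (Ed d)) (k : ℕ) : ℝ :=
  (volume (Pik d C k ∩ Metric.closedBall (0 : Ed d) 1)).toReal /
    (volume (Metric.closedBall (0 : Ed d) 1)).toReal

/-- The `k`-th spherical intrinsic volume of a fan. -/
def fanIntrinsicVol (d : ℕ) (N : Set (Set (Ed d))) (k : ℕ) : ℝ :=
  ∑ᶠ C ∈ N, sphIntrinsicVol d C k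

/-- The indicator-valued spherical intrinsic volume
`V_k(C) = Σ_F [Π_F(C)]`, the sum over all `k`-dimensional faces `F` of `C` of the
indicator functions of `Π_F(C) = π_C⁻¹(F)`. -/
def Vk (d : ℕ) (C : Set (Ed d)) (k : ℕ) (x : Ed d) : ℤ :=
  ∑ᶠ F ∈ {F | IsFaceOf d C F ∧ setDim d F = k},
    Set.indicator (metricProj d C ⁻¹' F) (fun _ => (1 : ℤ)) x

/-- The polar cone `C^∨`. -/
def polarCone (d : ℕ) (C : Set (Ed d)) : Set (Ed d) :=
  {c | ∀ x ∈ C, ⟪c, x⟫ ≤ 0}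

/-- The lattice of flats of an arrangement: all intersections of subfamilies (the empty
intersection being the ambient space). -/
def flats (A : Arrangement d) : Set (Submodule ℝ (Ed d)) :=
  {L | ∃ S : Finset (Submodule ℝ (Ed d)), S ⊆ A.hyps ∧ L = A.space ⊓ S.inf id}

/-- `μ` is the Möbius function of the lattice of flats of `A`, ordered by *reverse*
inclusion: `μ(L,L) = 1` and `μ(L,M) = - Σ_{L ≼ Z ≺ M} μ(L,Z)` for `M ⊊ L`. -/
def IsMobiusOf (A : Arrangement d)
    (μ : Submodule ℝ (Ed d) → Submodule ℝ (Ed d) → ℤ) : Prop :=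
  (∀ L ∈ flats A, μ L L = 1) ∧
    ∀ L ∈ flats A, ∀ M ∈ flats A, M < L →
      μ L M = -∑ᶠ Z ∈ {Z | Z ∈ flats A ∧ Z ≤ L ∧ M < Z}, μ L Z

/-- A polyhedron: a nonempty finite intersection of closed affine halfspaces. -/
def IsPolyhedron (d : ℕ) (Q : Set (Ed d)) : Prop :=
  Q.Nonempty ∧ ∃ s : Finset (Ed d × ℝ), Q = {x | ∀ p ∈ s, ⟪p.1, x⟫ ≤ p.2}

/-- A nonempty face of a polyhedron `Q`. -/
def IsFaceOfPolyhedron (d : ℕ) (Q F : Set (Ed d)) : Prop :=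
  F.Nonempty ∧ ∃ (c : Ed d) (α : ℝ), (∀ x ∈ Q, ⟪c, x⟫ ≤ α) ∧
    F = {x ∈ Q | ⟪c, x⟫ = α}

/-- Dimension of a subset of `ℝ^d` as dimension of its affine hull. -/
def polyDim (d : ℕ) (S : Set (Ed d)) : ℕ :=
  Module.finrank ℝ (vectorSpan ℝ S)

/-- The Euler characteristic `ε(Q) = Σ_F (-1)^(dim F)` of a polyhedron. -/
def eulerChar (d : ℕ) (Q : Set (Ed d)) : ℤ :=
  ∑ᶠ F ∈ {F | IsFaceOfPolyhedron d Q F}, (-1 : ℤ) ^ polyDim d F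

end

section Chambers

variable {d : ℕ}

/-- The complement in `L` of the hyperplanes with normal vectors in `S`. -/
def normalComplement (L : Submodule ℝ (Ed d)) (S : Finset (Ed d)) : Set (Ed d) :=
  {x | x ∈ L ∧ ∀ c ∈ S, ⟪c, x⟫ ≠ 0}

/-- The open chamber of `x`: points of `L` strictly on the same side as `x` of every hyperplane
with normal vector in `S`. -/
def openChamber (L : Submodule ℝ (Ed d)) (S : Finset (Ed d)) (x : Ed d) : Set (Ed d) :=
  {y | y ∈ L ∧ ∀ c ∈ S, 0 < ⟪c, x⟫ * ⟪c, y⟫}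

/-- The closed chamber of `x`: points of `L` weakly on the same side as `x` of every hyperplane
with normal vector in `S`. -/
def closedChamber (L : Submodule ℝ (Ed d)) (S : Finset (Ed d)) (x : Ed d) : Set (Ed d) :=
  {y | y ∈ L ∧ ∀ c ∈ S, 0 ≤ ⟪c, x⟫ * ⟪c, y⟫}

/-- The fan of closed chambers cut out in `L` by the hyperplanes with normal vectors in `S`. -/
def chamberFan (L : Submodule ℝ (Ed d)) (S : Finset (Ed d)) : Set (Set (Ed d)) :=
  closedChamber L S '' normalComplement L S

variable {L : Submodule ℝ (Ed d)} {S : Finset (Ed d)} {x y z c : Ed d}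

lemma self_mem_openChamber (hx : x ∈ normalComplement L S) : x ∈ openChamber L S x :=
  ⟨hx.1, fun c hc => mul_self_pos.2 (hx.2 c hc)⟩

lemma openChamber_subset_closedChamber : openChamber L S x ⊆ closedChamber L S x :=
  fun _ hy => ⟨hy.1, fun c hc => (hy.2 c hc).le⟩

lemma openChamber_subset_normalComplement : openChamber L S x ⊆ normalComplement L S :=
  fun _ hy => ⟨hy.1, fun c hc => right_ne_zero_of_mul (hy.2 c hc).ne'⟩

lemma zero_mem_closedChamber : (0 : Ed d) ∈ closedChamber L S x :=
  ⟨L.zero_mem, fun c _ => by simp⟩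

lemma closedChamber_eq_of_mem (hy : y ∈ openChamber L S x) :
    closedChamber L S y = closedChamber L S x := by
  ext z
  refine and_congr_right fun _ => forall₂_congr fun c hc => ?_
  rcases mul_pos_iff.1 (hy.2 c hc) with ⟨h1, h2⟩ | ⟨h1, h2⟩
  · rw [mul_nonneg_iff_of_pos_left h1, mul_nonneg_iff_of_pos_left h2]
  · rw [← neg_mul_neg, mul_nonneg_iff_of_pos_left (neg_pos.2 h2), ← neg_mul_neg,
      mul_nonneg_iff_of_pos_left (neg_pos.2 h1)]

lemma isOpen_sign_conditions (S : Finset (Ed d)) (x : Ed d) :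
    IsOpen {y : Ed d | ∀ c ∈ S, 0 < ⟪c, x⟫ * ⟪c, y⟫} := by
  simp only [Set.ofPred_forall]
  exact isOpen_biInter_finset fun c _ => isOpen_lt continuous_const (by fun_prop)

lemma exists_add_smul_mem_openChamber (hy : y ∈ openChamber L S x) (hz : z ∈ L) :
    ∃ t : ℝ, 0 < t ∧ y + t • z ∈ openChamber L S x := by
  have hcont : Continuous fun t : ℝ => y + t • z := by fun_prop
  have hev := hcont.continuousAt.eventually_mem (x := (0 : ℝ))
    ((isOpen_sign_conditions S x).mem_nhds (by simpa using hy.2))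
  obtain ⟨t, ht, ht0⟩ := ((hev.filter_mono nhdsWithin_le_nhds).and
    (self_mem_nhdsWithin (s := Set.Ioi 0))).exists
  exact ⟨t, ht0, L.add_mem hy.1 (L.smul_mem t hz), ht⟩

lemma connectedComponentIn_normalComplement (hx : x ∈ normalComplement L S) :
    connectedComponentIn (normalComplement L S) x = openChamber L S x := by
  apply subset_antisymm
  · intro y hy
    have hsub := connectedComponentIn_subset (normalComplement L S) x
    refine ⟨(hsub hy).1, fun c hc => ?_⟩
    by_contra! hle
    obtain ⟨z, hz, hz0⟩ := isPreconnected_connectedComponentIn.intermediate_value hy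
      (mem_connectedComponentIn hx) (f := fun y => ⟪c, x⟫ * ⟪c, y⟫) (by fun_prop)
      ⟨hle, mul_self_nonneg _⟩
    exact mul_ne_zero (hx.2 c hc) ((hsub hz).2 c hc) hz0
  · refine IsPreconnected.subset_connectedComponentIn (Convex.isPreconnected ?_)
      (self_mem_openChamber hx) openChamber_subset_normalComplement
    intro y hy z hz a b ha hb hab
    refine ⟨L.add_mem (L.smul_mem a hy.1) (L.smul_mem b hz.1), fun c hc => ?_⟩
    have h := convex_Ioi (0 : ℝ) (hy.2 c hc) (hz.2 c hc) ha hb hab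
    simp only [smul_eq_mul, Set.mem_Ioi] at h
    rw [inner_add_right, inner_smul_right, inner_smul_right]
    linarith

lemma closure_openChamber (hx : x ∈ normalComplement L S) :
    closure (openChamber L S x) = closedChamber L S x := by
  apply subset_antisymm
  · refine closure_minimal openChamber_subset_closedChamber ?_
    have : closedChamber L S x = (L : Set (Ed d)) ∩ ⋂ c ∈ S, {y | 0 ≤ ⟪c, x⟫ * ⟪c, y⟫} := by
      ext; simp [closedChamber]
    rw [this]
    exact L.closed_of_finiteDimensional.inter
      (isClosed_biInter fun c _ => isClosed_le continuous_const (by fun_prop))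
  · intro y hy
    have hcont : Continuous fun t : ℝ => y + t • x := by fun_prop
    have htend : Filter.Tendsto (fun t : ℝ => y + t • x) (nhdsWithin 0 (Set.Ioi 0)) (nhds y) := by
      simpa using (hcont.tendsto 0).mono_left nhdsWithin_le_nhds
    refine mem_closure_of_tendsto htend ?_
    filter_upwards [self_mem_nhdsWithin] with t ht
    refine ⟨L.add_mem hy.1 (L.smul_mem t hx.1), fun c hc => ?_⟩
    have := mul_pos (Set.mem_Ioi.1 ht) (mul_self_pos.2 (hx.2 c hc))
    rw [inner_add_right, inner_smul_right]
    linarith [hy.2 c hc]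

lemma arrFan_eq_chamberFan (A : Arrangement d)
    (h : arrComplement A = normalComplement L S) : arrFan A = chamberFan L S := by
  ext C
  simp only [arrFan, chamberFan, h, Set.mem_ofPred_eq, Set.mem_image]
  refine exists_congr fun x => and_congr_right fun hx => ?_
  rw [connectedComponentIn_normalComplement hx, closure_openChamber hx, eq_comm]

lemma span_closedChamber (hx : x ∈ normalComplement L S) :
    Submodule.span ℝ (closedChamber L S x) = L := by
  apply le_antisymm (Submodule.span_le.2 fun y hy => hy.1)
  intro v hv
  obtain ⟨t, ht, hmem⟩ := exists_add_smul_mem_openChamber (self_mem_openChamber hx) hv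
  have h1 := Submodule.subset_span (R := ℝ) (openChamber_subset_closedChamber hmem)
  have h2 := Submodule.subset_span (R := ℝ)
    (openChamber_subset_closedChamber (self_mem_openChamber hx))
  have h3 := Submodule.sub_mem _ h1 h2
  rw [add_sub_cancel_left] at h3
  exact (Submodule.smul_mem_iff _ ht.ne').1 h3

lemma intrinsicInterior_closedChamber (hx : x ∈ normalComplement L S) :
    intrinsicInterior ℝ (closedChamber L S x) = openChamber L S x := by
  have h0 : (0 : Ed d) ∈ affineSpan ℝ (closedChamber L S x) :=
    subset_affineSpan ℝ _ zero_mem_closedChamber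
  have hxs : x ∈ affineSpan ℝ (closedChamber L S x) :=
    subset_affineSpan ℝ _ (openChamber_subset_closedChamber (self_mem_openChamber hx))
  have hle : affineSpan ℝ (closedChamber L S x) ≤ L.toAffineSubspace :=
    affineSpan_le.2 fun y hy => hy.1
  ext y
  rw [mem_intrinsicInterior]
  constructor
  · rintro ⟨y, hy, rfl⟩
    refine ⟨(Set.mem_preimage.1 (interior_subset hy)).1, fun c hc => ?_⟩
    let γ : ℝ → affineSpan ℝ (closedChamber L S x) := fun t =>
      ⟨t • ((0 : Ed d) -ᵥ x) +ᵥ (y : Ed d), AffineSubspace.smul_vsub_vadd_mem _ t h0 hxs y.2⟩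
    have hγ : Continuous γ := by
      refine Continuous.subtype_mk ?_ _
      simp only [vsub_eq_sub, vadd_eq_add]
      fun_prop
    have hγ0 : γ 0 = y := by
      ext1
      simp [γ]
    have hev := hγ.continuousAt.eventually_mem (x := (0 : ℝ))
      (isOpen_interior.mem_nhds (by rw [hγ0]; exact hy))
    obtain ⟨t, ht, ht0⟩ := ((hev.filter_mono nhdsWithin_le_nhds).and
      (self_mem_nhdsWithin (s := Set.Ioi 0))).exists
    have h := (Set.mem_preimage.1 (interior_subset ht)).2 c hc
    have hp := mul_pos (Set.mem_Ioi.1 ht0) (mul_self_pos.2 (hx.2 c hc))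
    simp only [γ, vsub_eq_sub, vadd_eq_add, zero_sub, inner_add_right, inner_smul_right,
      inner_neg_right] at h
    linarith
  · intro hy
    refine ⟨⟨y, subset_affineSpan ℝ _ (openChamber_subset_closedChamber hy)⟩, ?_, rfl⟩
    refine mem_interior.2 ⟨Subtype.val ⁻¹' {y : Ed d | ∀ c ∈ S, 0 < ⟪c, x⟫ * ⟪c, y⟫}, ?_,
      (isOpen_sign_conditions S x).preimage continuous_subtype_val, hy.2⟩
    exact fun z hz => openChamber_subset_closedChamber ⟨hle z.2, hz⟩

lemma isPolyCone_closedChamber : IsPolyCone d (closedChamber L S x) := by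
  classical
  obtain ⟨T, hT⟩ := (IsNoetherian.noetherian Lᗮ : Lᗮ.FG)
  refine ⟨T ∪ T.image (- ·) ∪ S.image fun c => -(⟪c, x⟫ • c), ?_⟩
  ext y
  have hL : y ∈ L ↔ ∀ c ∈ T, ⟪c, y⟫ = 0 := by
    rw [← Submodule.orthogonal_orthogonal L, ← hT, Submodule.mem_orthogonal]
    refine ⟨fun h c hc => h c (Submodule.subset_span hc), fun h u hu => ?_⟩
    induction hu using Submodule.span_induction with
    | mem u hu => exact h u hu
    | zero => simp
    | add u v _ _ hu hv => rw [inner_add_left, hu, hv, add_zero]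
    | smul a u _ hu => rw [real_inner_smul_left, hu, mul_zero]
  simp only [closedChamber, hL, Set.mem_ofPred_eq, Finset.mem_union, Finset.mem_image, or_imp,
    forall_and, forall_exists_index, and_imp, forall_apply_eq_imp_iff₂, inner_neg_left,
    real_inner_smul_left, Left.neg_nonpos_iff, le_antisymm_iff]

lemma isFaceOf_closedChamber_inter (L : Submodule ℝ (Ed d)) (S : Finset (Ed d)) (x x' : Ed d)
    (hx : x ∈ normalComplement L S) :
    IsFaceOf d (closedChamber L S x) (closedChamber L S x ∩ closedChamber L S x') := by
  classical
  have hinner (y : Ed d) :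
      ⟪∑ c ∈ S with ⟪c, x⟫ * ⟪c, x'⟫ < 0, -(⟪c, x⟫ • c), y⟫
        = -∑ c ∈ S with ⟪c, x⟫ * ⟪c, x'⟫ < 0, ⟪c, x⟫ * ⟪c, y⟫ := by
    simp [sum_inner, real_inner_smul_left]
  have hnonneg : ∀ y ∈ closedChamber L S x, ∀ c ∈ S.filter (fun c => ⟪c, x⟫ * ⟪c, x'⟫ < 0),
      0 ≤ ⟪c, x⟫ * ⟪c, y⟫ := fun y hy c hc => hy.2 c (Finset.mem_filter.1 hc).1
  refine ⟨∑ c ∈ S with ⟪c, x⟫ * ⟪c, x'⟫ < 0, -(⟪c, x⟫ • c), fun y hy => ?_, ?_⟩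
  · rw [hinner, neg_nonpos]
    exact Finset.sum_nonneg (hnonneg y hy)
  · ext y
    refine and_congr_right fun hy => ?_
    rw [hinner, neg_eq_zero, Finset.sum_eq_zero_iff_of_nonneg (hnonneg y hy)]
    constructor
    · intro hy' c hc
      obtain ⟨hcS, hneg⟩ := Finset.mem_filter.1 hc
      have h1 := hy.2 c hcS
      have h2 := hy'.2 c hcS
      have h3 := mul_nonneg h1 h2
      by_contra hne
      have h4 := mul_neg_of_neg_of_pos hneg (mul_self_pos.2 (right_ne_zero_of_mul hne))
      linarith
    · intro h
      refine ⟨hy.1, fun c hc => ?_⟩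
      by_cases hneg : ⟪c, x⟫ * ⟪c, x'⟫ < 0
      · have h0 := (mul_eq_zero.1 (h c (Finset.mem_filter.2 ⟨hc, hneg⟩))).resolve_left (hx.2 c hc)
        simp [h0]
      · have h1 := hy.2 c hc
        have h2 := mul_nonneg (not_lt.1 hneg) h1
        have h3 := mul_self_pos.2 (hx.2 c hc)
        refine nonneg_of_mul_nonneg_right (a := ⟪c, x⟫ * ⟪c, x⟫) ?_ h3
        linarith

lemma finite_chamberFan : (chamberFan L S).Finite := by
  classical
  refine (S.powerset.finite_toSet.image fun T =>
    {y | y ∈ L ∧ ∀ c ∈ S, if c ∈ T then 0 ≤ ⟪c, y⟫ else ⟪c, y⟫ ≤ 0}).subset ?_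
  rintro _ ⟨x, hx, rfl⟩
  refine ⟨S.filter fun c => 0 < ⟪c, x⟫, Finset.mem_powerset.2 (Finset.filter_subset _ S), ?_⟩
  ext y
  refine and_congr_right fun _ => forall₂_congr fun c hc => ?_
  rcases lt_or_gt_of_ne (hx.2 c hc) with h | h
  · rw [← neg_mul_neg, mul_nonneg_iff_of_pos_left (neg_pos.2 h)]
    simp [hc, h.not_gt]
  · simp [hc, h, mul_nonneg_iff_of_pos_left h]

lemma isFan_chamberFan (L : Submodule ℝ (Ed d)) (S : Finset (Ed d)) :
    IsFan d (chamberFan L S) := by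
  refine ⟨finite_chamberFan, ?_, ?_, ?_⟩
  · rintro _ ⟨x, -, rfl⟩
    exact isPolyCone_closedChamber
  · rintro _ ⟨x, hx, rfl⟩ _ ⟨x', hx', rfl⟩
    refine ⟨isFaceOf_closedChamber_inter L S x x' hx, ?_⟩
    rw [Set.inter_comm]
    exact isFaceOf_closedChamber_inter L S x' x hx'
  · rintro _ ⟨x, hx, rfl⟩ _ ⟨x', hx', rfl⟩
    rw [span_closedChamber hx, span_closedChamber hx']

lemma chamberFan_empty (L : Submodule ℝ (Ed d)) : chamberFan L ∅ = {(L : Set (Ed d))} := by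
  have h : closedChamber L ∅ = fun _ => (L : Set (Ed d)) := by
    ext x y
    simp [closedChamber]
  rw [chamberFan, h]
  have hne : (normalComplement L ∅).Nonempty := ⟨0, L.zero_mem, by simp⟩
  exact hne.image_const _

end Chambers

section DeletionRestriction

open Classical

variable {d : ℕ} {L : Submodule ℝ (Ed d)} {S : Finset (Ed d)} {c : Ed d}

lemma chamberFan_insert_neg : chamberFan L (insert (-c) S) = chamberFan L (insert c S) := by
  have h1 : closedChamber L (insert (-c) S) = closedChamber L (insert c S) := by
    ext x y
    simp [closedChamber]
  have h2 : normalComplement L (insert (-c) S) = normalComplement L (insert c S) := by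
    ext x
    simp [normalComplement]
  rw [chamberFan, h1, h2, chamberFan]

lemma fanInter_chamberFan_insert_le (hc : c ∈ L) (hc0 : c ≠ 0) :
    fanInter d (chamberFan L (insert c S)) {x | ⟪c, x⟫ ≤ 0}
      = fanInter d (chamberFan L S) {x | ⟪c, x⟫ ≤ 0} := by
  have key (x : Ed d) (hx : ⟪c, x⟫ < 0) :
      closedChamber L (insert c S) x ∩ {x | ⟪c, x⟫ ≤ 0}
        = closedChamber L S x ∩ {x | ⟪c, x⟫ ≤ 0} := by
    ext y
    simp only [closedChamber, Set.mem_inter_iff, Set.mem_ofPred_eq, Finset.forall_mem_insert]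
    have := fun h : ⟪c, y⟫ ≤ 0 => mul_nonneg_of_nonpos_of_nonpos hx.le h
    tauto
  ext D
  constructor
  · rintro ⟨_, ⟨x, hx, rfl⟩, ⟨y, hy, hyc⟩, rfl⟩
    rw [intrinsicInterior_closedChamber hx] at hy
    have hxc : ⟪c, x⟫ < 0 := by
      have := hy.2 c (Finset.mem_insert_self c S)
      by_contra! h
      exact this.not_ge (mul_nonpos_of_nonneg_of_nonpos h hyc)
    have hxS : x ∈ normalComplement L S :=
      ⟨hx.1, fun a ha => hx.2 a (Finset.mem_insert_of_mem ha)⟩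
    refine ⟨_, ⟨x, hxS, rfl⟩, ⟨x, ?_, hxc.le⟩, key x hxc⟩
    rw [intrinsicInterior_closedChamber hxS]
    exact self_mem_openChamber hxS
  · rintro ⟨_, ⟨x, hx, rfl⟩, ⟨y, hy, hyc⟩, rfl⟩
    rw [intrinsicInterior_closedChamber hx] at hy
    obtain ⟨t, ht, hz⟩ := exists_add_smul_mem_openChamber hy (L.neg_mem hc)
    have hzc : ⟪c, y + t • -c⟫ < 0 := by
      have := mul_pos ht (real_inner_self_pos.2 hc0)
      simp only [inner_add_right, inner_smul_right, inner_neg_right]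
      linarith [show ⟪c, y⟫ ≤ 0 from hyc]
    generalize y + t • -c = z at hz hzc
    have hz' : z ∈ normalComplement L (insert c S) :=
      ⟨hz.1, by simpa [hzc.ne] using (openChamber_subset_normalComplement hz).2⟩
    refine ⟨_, ⟨z, hz', rfl⟩, ⟨z, ?_, hzc.le⟩, ?_⟩
    · rw [intrinsicInterior_closedChamber hz']
      exact self_mem_openChamber hz'
    · rw [key z hzc, closedChamber_eq_of_mem hz]

lemma fanInter_chamberFan_insert_ge (hc : c ∈ L) (hc0 : c ≠ 0) :
    fanInter d (chamberFan L (insert c S)) {x | 0 ≤ ⟪c, x⟫}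
      = fanInter d (chamberFan L S) {x | 0 ≤ ⟪c, x⟫} := by
  have h := fanInter_chamberFan_insert_le (S := S) (L.neg_mem hc) (neg_ne_zero.2 hc0)
  simpa only [chamberFan_insert_neg, inner_neg_left, Left.neg_nonpos_iff] using h

lemma fanInter_chamberFan_insert_eq :
    fanInter d (chamberFan L (insert c S)) {x | ⟪c, x⟫ = 0} = ∅ := by
  refine Set.eq_empty_of_forall_notMem ?_
  rintro _ ⟨_, ⟨x, hx, rfl⟩, ⟨y, hy, hyc⟩, rfl⟩
  rw [intrinsicInterior_closedChamber hx] at hy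
  exact (openChamber_subset_normalComplement hy).2 c (Finset.mem_insert_self c S) hyc

lemma fanInter_chamberFan_eq :
    fanInter d (chamberFan L S) {x | ⟪c, x⟫ = 0} = chamberFan (L ⊓ (ℝ ∙ c)ᗮ) S := by
  have key (x : Ed d) : closedChamber (L ⊓ (ℝ ∙ c)ᗮ) S x
      = closedChamber L S x ∩ {x | ⟪c, x⟫ = 0} := by
    ext y
    simp only [closedChamber, Set.mem_inter_iff, Set.mem_ofPred_eq, Submodule.mem_inf,
      Submodule.mem_orthogonal_singleton_iff_inner_right]
    tauto
  ext D
  constructor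
  · rintro ⟨_, ⟨x, hx, rfl⟩, ⟨y, hy, hyc⟩, rfl⟩
    rw [intrinsicInterior_closedChamber hx] at hy
    refine ⟨y, ⟨⟨hy.1, Submodule.mem_orthogonal_singleton_iff_inner_right.2 hyc⟩,
      (openChamber_subset_normalComplement hy).2⟩, ?_⟩
    rw [key, closedChamber_eq_of_mem hy]
  · rintro ⟨x, hx, rfl⟩
    have hxL : x ∈ normalComplement L S := ⟨hx.1.1, hx.2⟩
    refine ⟨_, ⟨x, hxL, rfl⟩, ⟨x, ?_,
      Submodule.mem_orthogonal_singleton_iff_inner_right.1 hx.1.2⟩, key x⟩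
    rw [intrinsicInterior_closedChamber hxL]
    exact self_mem_openChamber hxL

lemma IsFanValuation.chamberFan_insert {G : Type*} [AddCommGroup G] {φ : Set (Set (Ed d)) → G}
    (hφ : IsFanValuation d φ) (hc : c ∈ L) (hc0 : c ≠ 0) :
    φ (chamberFan L (insert c S)) = φ (chamberFan L S) + φ (chamberFan (L ⊓ (ℝ ∙ c)ᗮ) S) := by
  have hspan (S : Finset (Ed d)) : ∀ C ∈ chamberFan L S, c ∈ Submodule.span ℝ C := by
    rintro _ ⟨x, hx, rfl⟩
    rwa [span_closedChamber hx]
  rw [hφ.2 _ (isFan_chamberFan L (insert c S)) c hc0 (hspan _),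
    hφ.2 _ (isFan_chamberFan L S) c hc0 (hspan _),
    fanInter_chamberFan_insert_le hc hc0, fanInter_chamberFan_insert_ge hc hc0,
    fanInter_chamberFan_insert_eq, fanInter_chamberFan_eq, hφ.1]
  abel

end DeletionRestriction

section Arrangements

variable {d : ℕ}

lemma IsHyperplaneOf.exists_normal {H L : Submodule ℝ (Ed d)} (h : IsHyperplaneOf d H L) :
    ∃ c ∈ L, c ≠ 0 ∧ H = L ⊓ (ℝ ∙ c)ᗮ := by
  have hne : Hᗮ ⊓ L ≠ ⊥ := by
    intro hbot
    have := Submodule.sup_orthogonal_inf_of_hasOrthogonalProjection h.1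
    rw [hbot, sup_bot_eq] at this
    have hrank := h.2
    rw [this] at hrank
    omega
  obtain ⟨c, hc, hc0⟩ := Submodule.exists_mem_ne_zero_of_ne_bot hne
  refine ⟨c, hc.2, hc0, ?_⟩
  have hle : H ≤ L ⊓ (ℝ ∙ c)ᗮ := le_inf h.1 fun x hx =>
    Submodule.mem_orthogonal_singleton_iff_inner_right.2
      (Submodule.inner_left_of_mem_orthogonal hx hc.1)
  have hlt : L ⊓ (ℝ ∙ c)ᗮ < L := by
    refine lt_of_le_of_ne inf_le_left fun heq => hc0 ?_
    have hcc : c ∈ L ⊓ (ℝ ∙ c)ᗮ := by rw [heq]; exact hc.2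
    exact inner_self_eq_zero.1 (Submodule.mem_orthogonal_singleton_iff_inner_right.1 hcc.2)
  refine Submodule.eq_of_le_of_finrank_le hle ?_
  have := Submodule.finrank_lt_finrank_of_lt hlt
  have := h.2
  omega

lemma Arrangement.IsArrangement.delete {A : Arrangement d} (hA : A.IsArrangement)
    (H : Submodule ℝ (Ed d)) : (A.delete H).IsArrangement :=
  fun H' hH' => hA H' (Finset.mem_of_mem_erase hH')

lemma Arrangement.IsArrangement.restrict {A : Arrangement d} (hA : A.IsArrangement)
    {H : Submodule ℝ (Ed d)} (hH : H ∈ A.hyps) : (A.restrict H).IsArrangement := by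
  intro K hK
  obtain ⟨H', hH', rfl⟩ := Finset.mem_image.1 hK
  obtain ⟨hne, hH'A⟩ := Finset.mem_erase.1 hH'
  refine ⟨inf_le_right, ?_⟩
  have h1 := hA H hH
  have h2 := hA H' hH'A
  have h3 := Submodule.finrank_sup_add_finrank_inf_eq H' H
  have hlt : H < H' ⊔ H := by
    refine lt_of_le_of_ne le_sup_right fun heq => hne ?_
    have hle : H' ≤ H := heq ▸ le_sup_left
    exact Submodule.eq_of_le_of_finrank_eq hle (by have := h1.2; have := h2.2; omega)
  have h4 := Submodule.finrank_lt_finrank_of_lt hlt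
  have h5 := Submodule.finrank_mono (sup_le h2.1 h1.1)
  have := h1.2
  have := h2.2
  change Module.finrank ℝ ↥(H' ⊓ H) + 1 = Module.finrank ℝ H
  omega

lemma IsFanValuation.arrFan_eq_delete_add_restrict {G : Type*} [AddCommGroup G]
    {φ : Set (Set (Ed d)) → G} (hφ : IsFanValuation d φ) {A : Arrangement d}
    (hA : A.IsArrangement) {H : Submodule ℝ (Ed d)} (hH : H ∈ A.hyps) :
    φ (arrFan A) = φ (arrFan (A.delete H)) + φ (arrFan (A.restrict H)) := by
  classical
  have hex (K : Submodule ℝ (Ed d)) :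
      ∃ c : Ed d, K ∈ A.hyps → c ∈ A.space ∧ c ≠ 0 ∧ K = A.space ⊓ (ℝ ∙ c)ᗮ := by
    by_cases hK : K ∈ A.hyps
    · obtain ⟨c, hc⟩ := (hA K hK).exists_normal
      exact ⟨c, fun _ => hc⟩
    · exact ⟨0, fun h => absurd h hK⟩
  choose n hn using hex
  have hmem {K : Submodule ℝ (Ed d)} (hK : K ∈ A.hyps) {x : Ed d} (hx : x ∈ A.space) :
      x ∈ K ↔ ⟪n K, x⟫ = 0 := by
    conv_lhs => rw [(hn K hK).2.2]
    rw [Submodule.mem_inf, Submodule.mem_orthogonal_singleton_iff_inner_right]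
    exact and_iff_right hx
  have hcompl : arrComplement A
      = normalComplement A.space (insert (n H) ((A.hyps.erase H).image n)) := by
    rw [← Finset.image_insert, Finset.insert_erase hH]
    ext x
    simp only [arrComplement, normalComplement, Set.mem_sdiff, SetLike.mem_coe, Set.mem_iUnion,
      not_exists, Finset.forall_mem_image, Set.mem_ofPred_eq]
    exact and_congr_right fun hx => forall₂_congr fun K hK => not_congr (hmem hK hx)
  have hdelete : arrComplement (A.delete H)
      = normalComplement A.space ((A.hyps.erase H).image n) := by
    ext x
    simp only [arrComplement, normalComplement, Set.mem_sdiff, SetLike.mem_coe, Set.mem_iUnion,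
      not_exists, Finset.forall_mem_image, Set.mem_ofPred_eq, Arrangement.delete]
    refine and_congr_right fun hx => forall_congr' fun K => ?_
    simp only [Finset.mem_erase]
    exact forall_congr' fun hK => not_congr (hmem hK.2 hx)
  have hrestrict : arrComplement (A.restrict H)
      = normalComplement H ((A.hyps.erase H).image n) := by
    ext x
    simp only [arrComplement, normalComplement, Set.mem_sdiff, SetLike.mem_coe, Set.mem_iUnion,
      not_exists, Finset.forall_mem_image, Set.mem_ofPred_eq, Arrangement.restrict,
      Submodule.mem_inf]
    refine and_congr_right fun hx => forall_congr' fun K => ?_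
    simp only [Finset.mem_erase]
    refine forall_congr' fun hK => not_congr ?_
    rw [and_iff_left hx, hmem hK.2 ((hA H hH).1 hx)]
  obtain ⟨hc, hc0, hHc⟩ := hn H hH
  rw [arrFan_eq_chamberFan A hcompl, arrFan_eq_chamberFan _ hdelete,
    arrFan_eq_chamberFan _ hrestrict, hφ.chamberFan_insert hc hc0, ← hHc]

lemma arrFan_of_hyps_eq_empty {A : Arrangement d} (h : A.hyps = ∅) :
    arrFan A = {(A.space : Set (Ed d))} := by
  rw [arrFan_eq_chamberFan (L := A.space) (S := ∅) A
    (by ext; simp [arrComplement, normalComplement, h]), chamberFan_empty]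

end Arrangements

section Rotations

variable {d : ℕ}

lemma det_linearIsometryEquiv_eq_one_or (g : Ed d ≃ₗᵢ[ℝ] Ed d) :
    LinearMap.det (g.toLinearEquiv : Ed d →ₗ[ℝ] Ed d) = 1 ∨
      LinearMap.det (g.toLinearEquiv : Ed d →ₗ[ℝ] Ed d) = -1 := by
  have h := g.toLinearIsometry.normDet_eq_one
  rw [LinearMap.normDet_eq_abs_det] at h
  exact eq_or_eq_neg_of_abs_eq h

lemma exists_nonzero_mem_or_mem_orthogonal (hd : 0 < d) (L : Submodule ℝ (Ed d)) :
    ∃ v : Ed d, v ≠ 0 ∧ (v ∈ L ∨ v ∈ Lᗮ) := by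
  by_cases hL : L = ⊥
  · subst hL
    have : Nonempty (Fin d) := ⟨⟨0, hd⟩⟩
    obtain ⟨v, hv⟩ := exists_ne (0 : Ed d)
    exact ⟨v, hv, Or.inr (by simp)⟩
  · obtain ⟨v, hv, hv0⟩ := Submodule.exists_mem_ne_zero_of_ne_bot hL
    exact ⟨v, hv0, Or.inl hv⟩

lemma reflection_orthogonal_singleton_mem {L : Submodule ℝ (Ed d)} {v x : Ed d}
    (hv : v ∈ L ∨ v ∈ Lᗮ) (hx : x ∈ L) : (ℝ ∙ v)ᗮ.reflection x ∈ L := by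
  rcases hv with hv | hv
  · rw [Submodule.reflection_orthogonal_apply, Submodule.reflection_singleton_apply]
    exact L.neg_mem (L.sub_mem (L.nsmul_mem (L.smul_mem _ hv) 2) hx)
  · rw [Submodule.reflection_mem_subspace_eq_self]
    · exact hx
    · exact Submodule.mem_orthogonal_singleton_iff_inner_left.2
        (Submodule.inner_right_of_mem_orthogonal hx hv)

lemma isRotation_of_reflection_trans {g : Ed d ≃ₗᵢ[ℝ] Ed d} {v : Ed d} (hv : v ≠ 0)
    (hg : LinearMap.det (g.toLinearEquiv : Ed d →ₗ[ℝ] Ed d) = -1) :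
    IsRotation d (g.trans (ℝ ∙ v)ᗮ.reflection) := by
  have h := Submodule.det_reflection (ℝ ∙ v)ᗮ
  rw [Submodule.orthogonal_orthogonal, finrank_span_singleton hv, pow_one] at h
  have hcomp : ((g.trans (ℝ ∙ v)ᗮ.reflection).toLinearEquiv : Ed d →ₗ[ℝ] Ed d)
      = (ℝ ∙ v)ᗮ.reflection.toLinearMap ∘ₗ (g.toLinearEquiv : Ed d →ₗ[ℝ] Ed d) := rfl
  rw [IsRotation, hcomp, LinearMap.det_comp, h, hg]
  norm_num

lemma exists_isRotation_image_eq {L L' : Submodule ℝ (Ed d)}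
    (h : Module.finrank ℝ L = Module.finrank ℝ L') :
    ∃ g : Ed d ≃ₗᵢ[ℝ] Ed d, IsRotation d g ∧ g '' (L : Set (Ed d)) = L' := by
  suffices ∃ g : Ed d ≃ₗᵢ[ℝ] Ed d, IsRotation d g ∧ ∀ x ∈ L, g x ∈ L' by
    obtain ⟨g, hg, hmap⟩ := this
    refine ⟨g, hg, ?_⟩
    have hle : L.map g.toLinearEquiv.toLinearMap ≤ L' := Submodule.map_le_iff_le_comap.2 hmap
    have heq := Submodule.eq_of_le_of_finrank_eq hle
      ((LinearEquiv.finrank_map_eq g.toLinearEquiv L).trans h)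
    rw [← heq]
    rfl
  let e : L ≃ₗᵢ[ℝ] L' :=
    (stdOrthonormalBasis ℝ L).equiv (stdOrthonormalBasis ℝ L') (finCongr h)
  obtain ⟨f, hf⟩ : ∃ f : Ed d ≃ₗᵢ[ℝ] Ed d, ∀ x ∈ L, f x ∈ L' := by
    refine ⟨(L'.subtypeₗᵢ.comp e.toLinearIsometry).extend.toLinearIsometryEquiv rfl,
      fun x hx => ?_⟩
    have := (L'.subtypeₗᵢ.comp e.toLinearIsometry).extend_apply ⟨x, hx⟩
    change (L'.subtypeₗᵢ.comp e.toLinearIsometry).extend x ∈ L'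
    rw [this]
    exact (e ⟨x, hx⟩).2
  rcases det_linearIsometryEquiv_eq_one_or f with hdet | hdet
  · exact ⟨f, hdet, hf⟩
  · have hd : 0 < d := by
      rcases Nat.eq_zero_or_pos d with rfl | hd
      · rw [LinearMap.det_eq_one_of_subsingleton] at hdet
        norm_num at hdet
      · exact hd
    obtain ⟨v, hv0, hv⟩ := exists_nonzero_mem_or_mem_orthogonal hd L'
    refine ⟨f.trans (ℝ ∙ v)ᗮ.reflection, isRotation_of_reflection_trans hv0 hdet, fun x hx => ?_⟩
    rw [LinearIsometryEquiv.trans_apply]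
    exact reflection_orthogonal_singleton_mem hv (hf x hx)

lemma exists_forall_eq_finrank_of_rotation_invariant {G : Type*} [AddCommGroup G]
    (φ : Set (Set (Ed d)) → G)
    (hinv : ∀ g : Ed d ≃ₗᵢ[ℝ] Ed d, IsRotation d g →
      ∀ N : Set (Set (Ed d)), IsFan d N → φ (fanMap d g N) = φ N) :
    ∃ g : ℕ → G, ∀ L : Submodule ℝ (Ed d),
      φ {(L : Set (Ed d))} = g (Module.finrank ℝ L) := by
  classical
  refine ⟨fun k => if h : ∃ L : Submodule ℝ (Ed d), Module.finrank ℝ L = k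
    then φ {(h.choose : Set (Ed d))} else 0, fun L => ?_⟩
  have hex : ∃ L' : Submodule ℝ (Ed d), Module.finrank ℝ L' = Module.finrank ℝ L := ⟨L, rfl⟩
  simp only [dif_pos hex]
  obtain ⟨g, hg, hgL⟩ := exists_isRotation_image_eq hex.choose_spec
  have h := hinv g hg {(hex.choose : Set (Ed d))}
    (chamberFan_empty hex.choose ▸ isFan_chamberFan _ ∅)
  rw [fanMap, Set.image_singleton, hgL] at h
  exact h

end Rotations

/-- A rotation-invariant fan valuation evaluates on arrangement fans
as a fixed `G`-combination of the unsigned Whitney numbers of the first kind. -/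
theorem rotation_invariant_fan_valuation_eq_whitney_combination
    (d : ℕ) {G : Type*} [AddCommGroup G] (φ : Set (Set (Ed d)) → G)
    (hval : IsFanValuation d φ)
    (hinv : ∀ g : Ed d ≃ₗᵢ[ℝ] Ed d, IsRotation d g →
      ∀ N : Set (Set (Ed d)), IsFan d N → φ (fanMap d g N) = φ N) :
    ∃ g : ℕ → G, ∀ A : Arrangement d, A.IsArrangement →
      ∀ p : Polynomial ℤ, IsCharPoly d A p →
        φ (arrFan A) = ∑ i ∈ Finset.range (d + 1), p.coeff i • g i := by
  obtain ⟨g, hg⟩ := exists_forall_eq_finrank_of_rotation_invariant φ hinv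
  refine ⟨g, fun A hA p hp => ?_⟩
  induction hp with
  | singleton A k hk hsing =>
    obtain ⟨H, hH⟩ := Finset.card_eq_one.1 hsing.2.1
    have hHA : H ∈ A.hyps := by simp [hH]
    have hfin := (hA H hHA).2
    have hdim : Module.finrank ℝ A.space = k := hsing.2.2
    have hkd : k ≤ d := by
      simpa [hdim] using Submodule.finrank_le A.space
    have hHk : Module.finrank ℝ H = k - 1 := by omega
    rw [hval.arrFan_eq_delete_add_restrict hA hHA,
      arrFan_of_hyps_eq_empty (A := A.delete H) (by simp [Arrangement.delete, hH]),
      arrFan_of_hyps_eq_empty (A := A.restrict H) (by simp [Arrangement.restrict, hH])]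
    change φ {(A.space : Set (Ed d))} + φ {(H : Set (Ed d))} = _
    rw [hg, hg, hdim, hHk]
    simp only [Polynomial.coeff_add, Polynomial.coeff_X_pow, add_smul, ite_smul, one_smul,
      zero_smul, Finset.sum_add_distrib, Finset.sum_ite_eq', Finset.mem_range]
    rw [if_pos (by omega), if_pos (by omega)]
  | deletion_restriction A H hH hcard p q hp hq ihp ihq =>
    rw [hval.arrFan_eq_delete_add_restrict hA hH, ihp (hA.delete H), ihq (hA.restrict hH)]
    simp only [Polynomial.coeff_add, add_smul, Finset.sum_add_distrib]
end

section
/- Let N be a fan in ℝ^d none of whose cones is a linear subspace. Then the alternating sum of its spherical intrinsic volumes vanishes: Σ_{k=0}^d (−1)^k v_k(N) = 0; that is, χ̄_N(−1) = 0 for the characteristic polynomial χ̄_N(t) = Σ_k v_k(N) t^k. -/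
open scoped Pointwise
open MeasureTheory RealInnerProductSpace

section DegreeFormula

open Metric Set
open scoped NNReal

section Normed

variable {E : Type*} [NormedAddCommGroup E] [NormedSpace ℝ E] [FiniteDimensional ℝ E]

/-- `t ↦ det (A + t • B)` is a polynomial function of degree at most `dim E`. -/
theorem exists_polynomial_eval_eq_det_add_smul (A B : E →L[ℝ] E) :
    ∃ p : Polynomial ℝ, p.natDegree ≤ Module.finrank ℝ E ∧
      ∀ t : ℝ, p.eval t = (A + t • B).det := by
  let b := Module.finBasis ℝ E
  let M : (E →L[ℝ] E) → Matrix (Fin (Module.finrank ℝ E)) (Fin (Module.finrank ℝ E)) ℝ :=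
    fun L => LinearMap.toMatrix b b L
  refine ⟨((Polynomial.X : Polynomial ℝ) • (M B).map Polynomial.C
    + (M A).map Polynomial.C).det, ?_, fun t => ?_⟩
  · simpa using Polynomial.natDegree_det_X_add_C_le (M B) (M A)
  · rw [ContinuousLinearMap.det, ← LinearMap.det_toMatrix b, ← Polynomial.coe_evalRingHom,
      RingHom.map_det]
    congr 1
    ext i j
    simp [M, LinearMap.toMatrix_apply, add_comm, mul_comm t]

/-- Two integrals of determinants of linear pencils that agree for all small positive parameters
agree for all parameters. -/
theorem integral_det_add_smul_eq_of_small {α : Type*} [MeasurableSpace α] {μ : Measure α}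
    (A B A' B' : α → E →L[ℝ] E)
    (hi : ∀ t : ℝ, Integrable (fun x => (A x + t • B x).det) μ)
    (hi' : ∀ t : ℝ, Integrable (fun x => (A' x + t • B' x).det) μ)
    {ε : ℝ} (hε : 0 < ε)
    (h : ∀ t : ℝ, 0 ≤ t → t < ε →
      ∫ x, (A x + t • B x).det ∂μ = ∫ x, (A' x + t • B' x).det ∂μ) (t : ℝ) :
    ∫ x, (A x + t • B x).det ∂μ = ∫ x, (A' x + t • B' x).det ∂μ := by
  set n := Module.finrank ℝ E
  let v : ℕ → ℝ := fun i => ε * (i / (n + 1))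
  have hn : (0 : ℝ) < n + 1 := by positivity
  have hv : Set.InjOn v (Finset.range (n + 1)) := by
    intro i _ j _ hij
    have := mul_left_cancel₀ hε.ne' hij
    rw [div_left_inj' hn.ne'] at this
    exact_mod_cast this
  have key : ∀ A B : E →L[ℝ] E, (A + t • B).det =
      ∑ i ∈ Finset.range (n + 1),
        (A + v i • B).det * (Lagrange.basis (Finset.range (n + 1)) v i).eval t := by
    intro A B
    obtain ⟨p, hp, hpe⟩ := exists_polynomial_eval_eq_det_add_smul A B
    have hdeg : p.degree < (Finset.range (n + 1)).card := by
      rw [Finset.card_range]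
      refine lt_of_le_of_lt Polynomial.degree_le_natDegree ?_
      exact_mod_cast Nat.lt_succ_of_le hp
    rw [← hpe, Lagrange.eq_interpolate hv hdeg, Lagrange.interpolate_apply,
      Polynomial.eval_finsetSum]
    simp [hpe]
  simp_rw [key]
  rw [integral_finsetSum _ fun i _ => (hi _).mul_const _,
    integral_finsetSum _ fun i _ => (hi' _).mul_const _]
  refine Finset.sum_congr rfl fun i hi => ?_
  rw [integral_mul_const, integral_mul_const, h (v i) (by positivity)]
  have : (i : ℝ) < n + 1 := by exact_mod_cast Finset.mem_range.1 hi
  calc ε * (i / (n + 1)) < ε * 1 := by gcongr; rwa [div_lt_one hn]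
    _ = ε := mul_one ε

/-- The determinant is bounded on bounded sets of endomorphisms. -/
theorem exists_norm_det_le (R : ℝ) : ∃ M, ∀ A : E →L[ℝ] E, ‖A‖ ≤ R → ‖A.det‖ ≤ M := by
  obtain ⟨M, hM⟩ := (isCompact_closedBall (0 : E →L[ℝ] E) R).exists_bound_of_continuousOn
    (ContinuousLinearMap.continuous_det (𝕜 := ℝ) (E := E)).continuousOn
  exact ⟨M, fun A hA => hM A (by simpa using hA)⟩

omit [FiniteDimensional ℝ E] in
theorem exists_pos_forall_det_pos :
    ∃ δ > 0, ∀ A : E →L[ℝ] E, ‖A - 1‖ < δ → 0 < A.det := by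
  have h1 : (1 : E →L[ℝ] E).det = 1 := by simp [ContinuousLinearMap.det]
  have := (ContinuousLinearMap.continuous_det (𝕜 := ℝ) (E := E)).continuousAt.eventually
    (lt_mem_nhds (by rw [h1]; exact one_pos) : ∀ᶠ y in nhds (1 : E →L[ℝ] E).det, 0 < y)
  obtain ⟨δ, hδ, H⟩ := Metric.eventually_nhds_iff.1 this
  exact ⟨δ, hδ, fun A hA => H (by rwa [dist_eq_norm])⟩

/-- A perturbation of the identity by a strict contraction is bijective. -/
theorem bijective_id_add_of_lipschitz {h : E → E} {c : ℝ≥0} (hh : LipschitzWith c h)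
    (hc : c < 1) : Function.Bijective (fun x => x + h x) := by
  have ha : ApproximatesLinearOn (fun x => x + h x)
      ((ContinuousLinearEquiv.refl ℝ E : E ≃L[ℝ] E) : E →L[ℝ] E) univ c := by
    intro x _ y _
    have := hh.norm_sub_le x y
    simpa [add_sub_add_comm] using this
  have hc' : Subsingleton E ∨
      c < ‖((ContinuousLinearEquiv.refl ℝ E).symm : E →L[ℝ] E)‖₊⁻¹ := by
    rcases subsingleton_or_nontrivial E with hE | hE
    · exact Or.inl hE
    · right
      have : ‖((ContinuousLinearEquiv.refl ℝ E).symm : E →L[ℝ] E)‖₊ = 1 := by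
        ext
        exact ContinuousLinearMap.norm_id
      simpa [this] using hc
  exact ⟨injOn_univ.1 (ha.injOn hc'), ha.surjective hc'⟩

variable [MeasurableSpace E] [BorelSpace E] (μ : Measure E) [μ.IsAddHaarMeasure]

/-- Lipschitz maps of a finite-dimensional space into itself preserve null sets. -/
theorem LipschitzWith.addHaar_image_eq_zero {f : E → E} {K : ℝ≥0} (hf : LipschitzWith K f)
    {s : Set E} (hs : μ s = 0) : μ (f '' s) = 0 := by
  have : (Measure.hausdorffMeasure (Module.finrank ℝ E) : Measure E).IsAddHaarMeasure :=
    isAddHaarMeasure_hausdorffMeasure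
  have h1 := (Measure.absolutelyContinuous_isAddHaarMeasure
    (Measure.hausdorffMeasure (Module.finrank ℝ E) : Measure E) μ) hs
  refine (Measure.absolutelyContinuous_isAddHaarMeasure μ
    (Measure.hausdorffMeasure (Module.finrank ℝ E) : Measure E)) ?_
  have h2 := (hf.lipschitzOnWith (s := s)).hausdorffMeasure_image_le
    (d := Module.finrank ℝ E) (by positivity)
  rw [h1, mul_zero] at h2
  exact nonpos_iff_eq_zero.1 h2

/-- Area formula for an injective Lipschitz map. -/
theorem LipschitzWith.lintegral_abs_det_fderiv {f : E → E} {K : ℝ≥0} (hf : LipschitzWith K f)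
    (hinj : Function.Injective f) {s : Set E} (hs : MeasurableSet s) :
    ∫⁻ x in s, ENNReal.ofReal |(fderiv ℝ f x).det| ∂μ = μ (f '' s) := by
  set D : Set E := {x | DifferentiableAt ℝ f x}
  have hD : MeasurableSet D := measurableSet_of_differentiableAt ℝ f
  have hDc : μ Dᶜ = 0 := hf.ae_differentiableAt
  have hsD : (s ∩ D : Set E) =ᵐ[μ] s := by
    refine inter_ae_eq_left_of_ae_eq_univ ?_
    rwa [ae_eq_univ]
  rw [← setLIntegral_congr hsD, lintegral_abs_det_fderiv_eq_addHaar_image μ (hs.inter hD)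
    (fun x hx => hx.2.hasFDerivAt.hasFDerivWithinAt) hinj.injOn]
  refine le_antisymm (measure_mono (image_mono inter_subset_left)) ?_
  calc μ (f '' s) ≤ μ (f '' (s ∩ D) ∪ f '' Dᶜ) := by
        rw [← image_union]
        refine measure_mono (image_mono fun x hx => ?_)
        by_cases h : x ∈ D
        · exact Or.inl ⟨hx, h⟩
        · exact Or.inr h
    _ ≤ μ (f '' (s ∩ D)) + μ (f '' Dᶜ) := measure_union_le _ _
    _ = μ (f '' (s ∩ D)) := by rw [hf.addHaar_image_eq_zero μ hDc, add_zero]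

/-- For small Lipschitz perturbations of the identity, the integral of the Jacobian determinant
over a set is the volume of the image. -/
theorem exists_pos_forall_integral_det_eq_image :
    ∃ δ : ℝ≥0, 0 < δ ∧ ∀ (h : E → E) (c : ℝ≥0), LipschitzWith c h → c < δ →
      Function.Bijective (fun x => x + h x) ∧
      ∀ s : Set E, MeasurableSet s →
        ∫ x in s, (1 + fderiv ℝ h x).det ∂μ = (μ ((fun x => x + h x) '' s)).toReal := by
  obtain ⟨δ, hδ, hdet⟩ := exists_pos_forall_det_pos (E := E)
  refine ⟨min 1 δ.toNNReal, lt_min one_pos (Real.toNNReal_pos.2 hδ), fun h c hh hc => ?_⟩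
  have hb := bijective_id_add_of_lipschitz hh (hc.trans_le (min_le_left _ _))
  refine ⟨hb, fun s hs => ?_⟩
  have hlip : LipschitzWith (1 + c) (fun x => x + h x) := LipschitzWith.id.add hh
  rw [← hlip.lintegral_abs_det_fderiv μ hb.1 hs]
  have hpos : ∀ x, 0 < (1 + fderiv ℝ h x).det := fun x => by
    refine hdet _ ?_
    rw [add_sub_cancel_left]
    refine (norm_fderiv_le_of_lipschitz ℝ hh).trans_lt ?_
    have : c < δ.toNNReal := hc.trans_le (min_le_right _ _)
    exact Real.lt_toNNReal_iff_coe_lt.1 this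
  rw [integral_eq_lintegral_of_nonneg_ae (ae_of_all _ fun x => (hpos x).le)]
  · congr 1
    refine lintegral_congr_ae (ae_restrict_of_ae ?_)
    filter_upwards [hh.ae_differentiableAt (μ := μ)] with x hx
    rw [fderiv_fun_add differentiableAt_fun_id hx, fderiv_fun_id, abs_of_pos]
    · rfl
    · exact hpos x
  · exact (ContinuousLinearMap.continuous_det.measurable.comp
      ((measurable_fderiv ℝ h).const_add 1)).aestronglyMeasurable

omit [μ.IsAddHaarMeasure] in
theorem integrableOn_det_fderiv {f g : E → E} {Kf Kg : ℝ≥0} (hf : LipschitzWith Kf f)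
    (hg : LipschitzWith Kg g) (A : E →L[ℝ] E) (a b : ℝ) {s : Set E} (hs : μ s ≠ ⊤) :
    IntegrableOn (fun x => (A + a • fderiv ℝ f x + b • fderiv ℝ g x).det) s μ := by
  obtain ⟨M, hM⟩ := exists_norm_det_le (E := E) (‖A‖ + ‖a‖ * Kf + ‖b‖ * Kg)
  refine Measure.integrableOn_of_bounded (M := M) hs ?_ (ae_of_all _ fun x => hM _ ?_)
  · exact (ContinuousLinearMap.continuous_det.measurable.comp
      ((((measurable_fderiv ℝ f).const_smul a).const_add A).add
        ((measurable_fderiv ℝ g).const_smul b))).aestronglyMeasurable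
  · refine (norm_add_le _ _).trans (add_le_add ((norm_add_le _ _).trans
      (add_le_add le_rfl ?_)) ?_)
    · rw [norm_smul]
      gcongr
      exact norm_fderiv_le_of_lipschitz ℝ hf
    · rw [norm_smul]
      gcongr
      exact norm_fderiv_le_of_lipschitz ℝ hg

/-- The Jacobian integral `∫ₛ det (1 + a Df)` does not change when a Lipschitz map vanishing
outside `s` is added. -/
theorem integral_det_add_fderiv_eq {f g : E → E} {Kf Kg : ℝ≥0} (hf : LipschitzWith Kf f)
    (hg : LipschitzWith Kg g) {s : Set E} (hs : MeasurableSet s) (hμs : μ s ≠ ⊤)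
    (hgs : ∀ x ∉ s, g x = 0) (a : ℝ) :
    ∫ x in s, (1 + a • fderiv ℝ f x).det ∂μ =
      ∫ x in s, (1 + a • fderiv ℝ f x + fderiv ℝ g x).det ∂μ := by
  obtain ⟨δ, hδ, H⟩ := exists_pos_forall_integral_det_eq_image μ
  have hI := fun (A : E →L[ℝ] E) (a b : ℝ) => integrableOn_det_fderiv μ hf hg A a b hμs
  have small : ∀ (K : ℝ≥0), ∃ ε : ℝ, 0 < ε ∧ ∀ t : ℝ, 0 ≤ t → t < ε → ‖t‖₊ * K < δ / 2 := by
    intro K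
    refine ⟨(δ / 2 / (K + 1) : ℝ≥0), by positivity, fun t ht ht' => ?_⟩
    have h1 : ‖t‖₊ < δ / 2 / (K + 1) := by
      rw [← NNReal.coe_lt_coe]
      simpa [abs_of_nonneg ht] using ht'
    calc ‖t‖₊ * K ≤ ‖t‖₊ * (K + 1) := by gcongr; exact le_self_add
      _ < δ / 2 := by rwa [← lt_div_iff₀ (by positivity)]
  obtain ⟨ε, hε, hεf⟩ := small Kf
  obtain ⟨ε', hε', hεg⟩ := small Kg
  have vol : ∀ a b : ℝ, ‖a‖₊ * Kf < δ / 2 → ‖b‖₊ * Kg < δ / 2 →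
      Function.Bijective (fun x => x + (a • f x + b • g x)) ∧
      ∫ x in s, (1 + a • fderiv ℝ f x + b • fderiv ℝ g x).det ∂μ =
        (μ ((fun x => x + (a • f x + b • g x)) '' s)).toReal := by
    intro a b ha hb
    have hl : LipschitzWith (‖a‖₊ * Kf + ‖b‖₊ * Kg) (fun x => a • f x + b • g x) :=
      ((lipschitzWith_smul a).comp hf).add ((lipschitzWith_smul b).comp hg)
    obtain ⟨h1, h2⟩ := H _ _ hl (by simpa using add_lt_add ha hb)
    refine ⟨h1, ?_⟩
    rw [← h2 s hs]
    refine integral_congr_ae (ae_restrict_of_ae ?_)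
    filter_upwards [hf.ae_differentiableAt (μ := μ), hg.ae_differentiableAt (μ := μ)]
      with x hx hx'
    have hd : fderiv ℝ (fun x => a • f x + b • g x) x = a • fderiv ℝ f x + b • fderiv ℝ g x :=
      ((hx.hasFDerivAt.const_smul a).add (hx'.hasFDerivAt.const_smul b)).fderiv
    rw [hd, add_assoc]
  have image_eq : ∀ a b : ℝ, ‖a‖₊ * Kf < δ / 2 → ‖b‖₊ * Kg < δ / 2 →
      (fun x => x + (a • f x + b • g x)) '' s =
        (fun x => x + (a • f x + (0 : ℝ) • g x)) '' s := by
    intro a b ha hb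
    have e1 := (vol a b ha hb).1
    have e2 := (vol a 0 ha (by simpa using hδ)).1
    rw [← compl_inj_iff, ← image_compl_eq e1, ← image_compl_eq e2]
    refine image_congr fun x hx => ?_
    rw [hgs x hx]
    simp
  have step : ∀ a : ℝ, 0 ≤ a → a < ε → ∀ b : ℝ,
      ∫ x in s, (1 + a • fderiv ℝ f x + b • fderiv ℝ g x).det ∂μ =
        ∫ x in s, (1 + a • fderiv ℝ f x + b • (0 : E →L[ℝ] E)).det ∂μ := by
    intro a ha ha'
    refine integral_det_add_smul_eq_of_small (fun x => 1 + a • fderiv ℝ f x)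
      (fun x => fderiv ℝ g x) (fun x => 1 + a • fderiv ℝ f x) (fun _ => 0)
      (fun b => hI 1 a b) (fun b => by simpa using (hI 1 a 0).integrable) hε'
      fun b hb hb' => ?_
    have h1 := (vol a b (hεf a ha ha') (hεg b hb hb')).2
    have h2 := (vol a 0 (hεf a ha ha') (by simpa using hδ)).2
    rw [h1, image_eq a b (hεf a ha ha') (hεg b hb hb'), ← h2]
    simp
  have hfin := integral_det_add_smul_eq_of_small (μ := μ.restrict s) (fun _ => 1)
    (fun x => fderiv ℝ f x) (fun x => 1 + fderiv ℝ g x) (fun x => fderiv ℝ f x)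
    (fun a => by
      have := hI 1 a 0
      simp only [zero_smul, add_zero] at this
      exact this)
    (fun a => by simpa [add_right_comm] using (hI 1 a 1).integrable) hε (fun a ha ha' => by
      have := step a ha ha' 1
      simp only [one_smul, smul_zero, add_zero] at this
      simp only [← this, add_right_comm]) a
  rw [hfin]
  simp only [add_right_comm]

end Normed

section InnerProduct

variable {E : Type*} [NormedAddCommGroup E]

section Radial

variable [NormedSpace ℝ E]

/-- The radial map `y ↦ y / max ‖y‖ δ` is Lipschitz. -/
theorem lipschitzWith_inv_max_norm_smul {δ : ℝ≥0} (hδ : 0 < δ) :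
    LipschitzWith (2 / δ) (fun y : E => (max ‖y‖ δ)⁻¹ • y) := by
  refine LipschitzWith.of_dist_le_mul fun y z => ?_
  have hδ' : (0 : ℝ) < δ := hδ
  set a := max ‖y‖ (δ : ℝ) with ha
  set b := max ‖z‖ (δ : ℝ) with hb
  have ha0 : δ ≤ a := le_max_right _ _
  have hb0 : 0 < b := hδ'.trans_le (le_max_right _ _)
  have ha1 : 0 < a := hδ'.trans_le ha0
  have hab : |b - a| ≤ ‖y - z‖ := by
    refine (abs_max_sub_max_le_abs _ _ _).trans ?_
    rw [norm_sub_rev]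
    exact abs_norm_sub_norm_le _ _
  have hz : ‖z‖ / b ≤ 1 := (div_le_one hb0).2 (le_max_left _ _)
  have hdec : a⁻¹ • y - b⁻¹ • z = a⁻¹ • (y - z) + (a⁻¹ - b⁻¹) • z := by module
  have h1 : (a⁻¹ - b⁻¹) = (b - a) / b * a⁻¹ := by field_simp
  rw [dist_eq_norm, dist_eq_norm, hdec]
  calc ‖a⁻¹ • (y - z) + (a⁻¹ - b⁻¹) • z‖
      ≤ a⁻¹ * ‖y - z‖ + |b - a| * (‖z‖ / b) * a⁻¹ := by
        refine (norm_add_le _ _).trans (add_le_add ?_ ?_)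
        · rw [norm_smul, Real.norm_of_nonneg (by positivity)]
        · rw [norm_smul, h1, norm_mul, norm_div, Real.norm_eq_abs, Real.norm_of_nonneg hb0.le,
            Real.norm_of_nonneg (inv_nonneg.2 ha1.le)]
          exact le_of_eq (by ring)
    _ ≤ a⁻¹ * ‖y - z‖ + ‖y - z‖ * 1 * a⁻¹ := by gcongr
    _ = 2 / a * ‖y - z‖ := by ring
    _ ≤ (2 / δ : ℝ≥0) * ‖y - z‖ := by
        push_cast
        gcongr

end Radial

variable [InnerProductSpace ℝ E]

/-- The Jacobian determinant of a map of locally constant unit norm vanishes. -/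
theorem det_fderiv_eq_zero_of_norm_eq_one {F : E → E} {x : E} {L : E →L[ℝ] E}
    [FiniteDimensional ℝ E]
    (hL : HasFDerivAt F L x) (hF : ∀ᶠ y in nhds x, ‖F y‖ = 1) : L.det = 0 := by
  by_contra hdet
  have hu : IsUnit (L : E →ₗ[ℝ] E) :=
    (LinearMap.isUnit_iff_isUnit_det _).2 (isUnit_iff_ne_zero.2 hdet)
  obtain ⟨v, hv⟩ := ((Module.End.isUnit_iff _).1 hu).2 (F x)
  have h1 : HasFDerivAt (fun y => ‖F y‖ ^ 2) (2 • (innerSL ℝ (F x)).comp L) x := hL.norm_sq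
  have h2 : HasFDerivAt (fun y => ‖F y‖ ^ 2) (0 : E →L[ℝ] ℝ) x :=
    (hasFDerivAt_const (1 : ℝ) x).congr_of_eventuallyEq
      (hF.mono fun y hy => by simp [hy])
  have h3 := congrArg (fun T : E →L[ℝ] ℝ => T v) (h1.unique h2)
  have hv' : L v = F x := hv
  simp [hv', hF.self_of_nhds] at h3

variable [FiniteDimensional ℝ E] [MeasurableSpace E] [BorelSpace E]
  (μ : Measure E) [μ.IsAddHaarMeasure]

/-- If the reflected map `x ↦ 2 π x - x` is norm preserving and takes values in a closed
halfspace, then it has degree zero on the unit ball. -/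
theorem integral_det_one_sub_two_smul_fderiv_eq_zero {π : E → E} {K : ℝ≥0}
    (hπ : LipschitzWith K π) {e : E} (he : e ≠ 0) (horth : ∀ x, ⟪π x, x - π x⟫ = 0)
    (hhalf : ∀ x, 0 ≤ ⟪(2 : ℝ) • π x - x, e⟫) :
    ∫ x in ball (0 : E) 1, (1 + (-2 : ℝ) • fderiv ℝ π x).det ∂μ = 0 := by
  set R : E → E := fun x => (2 : ℝ) • π x - x with hR
  set Q : E → E := fun x => R x + max (1 - ‖x‖) 0 • e with hQ
  set δ : ℝ≥0 := min 1 ‖e‖₊ / 2 with hδ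
  have he0 : 0 < ‖e‖₊ := nnnorm_pos.2 he
  have hδ0 : 0 < δ := half_pos (lt_min one_pos he0)
  have hδ1 : (δ : ℝ) ≤ 1 / 2 := by
    have : δ ≤ 1 / 2 := div_le_div_of_nonneg_right (min_le_left _ _) (by simp)
    exact_mod_cast this
  have hδe : (δ : ℝ) ≤ ‖e‖ / 2 := by
    have : δ ≤ ‖e‖₊ / 2 := div_le_div_of_nonneg_right (min_le_right _ _) (by simp)
    exact_mod_cast this
  have hnR : ∀ x, ‖R x‖ = ‖x‖ := fun x => by
    have h1 : R x = π x - (x - π x) := by simp only [hR, two_smul]; abel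
    have h2 : ‖π x - (x - π x)‖ ^ 2 = ‖π x + (x - π x)‖ ^ 2 := by
      rw [norm_sub_sq_real, norm_add_sq_real, horth]
      ring
    rw [h1, ← sq_eq_sq₀ (norm_nonneg _) (norm_nonneg _), h2, add_sub_cancel]
  have hnQ : ∀ x, (δ : ℝ) ≤ ‖Q x‖ := fun x => by
    set m := max (1 - ‖x‖) 0 with hm
    have hm0 : 0 ≤ m := le_max_right _ _
    have hm1 : 1 - ‖x‖ ≤ m := le_max_left _ _
    have hsq : ‖x‖ ^ 2 + (m * ‖e‖) ^ 2 ≤ ‖Q x‖ ^ 2 := by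
      have : ‖Q x‖ ^ 2 = _ := norm_add_sq_real (R x) (m • e)
      rw [this, hnR, norm_smul, Real.norm_of_nonneg hm0, inner_smul_right]
      have := mul_nonneg hm0 (hhalf x)
      linarith
    rcases le_total (1 / 2) ‖x‖ with hx | hx
    · refine abs_le_of_sq_le_sq' ?_ (norm_nonneg _) |>.2
      nlinarith [sq_nonneg (m * ‖e‖), δ.2]
    · refine abs_le_of_sq_le_sq' ?_ (norm_nonneg _) |>.2
      have : (δ : ℝ) ≤ m * ‖e‖ := hδe.trans (by nlinarith [norm_nonneg e])
      nlinarith [sq_nonneg ‖x‖, δ.2]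
  have hRl : LipschitzWith (2 * K + 1) R := by
    have := ((lipschitzWith_smul (2 : ℝ)).comp hπ).sub LipschitzWith.id
    simpa using this
  have hQl : LipschitzWith (2 * K + 1 + ‖e‖₊) Q := by
    refine hRl.add (LipschitzWith.of_dist_le_mul fun x y => ?_)
    rw [dist_eq_norm, ← sub_smul, norm_smul, mul_comm, coe_nnnorm, dist_eq_norm]
    gcongr
    refine (abs_max_sub_max_le_abs _ _ _).trans ?_
    rw [sub_sub_sub_cancel_left, norm_sub_rev]
    exact abs_norm_sub_norm_le _ _
  set G : E → E := fun x =>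
    (max ‖R x‖ (1 : ℝ≥0))⁻¹ • R x - (max ‖Q x‖ δ)⁻¹ • Q x with hG
  have hGl : LipschitzWith _ G :=
    ((lipschitzWith_inv_max_norm_smul (E := E) one_pos).comp hRl).sub
      ((lipschitzWith_inv_max_norm_smul (E := E) hδ0).comp hQl)
  have hG0 : ∀ x ∉ ball (0 : E) 1, G x = 0 := fun x hx => by
    have hx1 : 1 ≤ ‖x‖ := by simpa using hx
    have hQR : Q x = R x := by simp [hQ, hx1]
    have h1 : max ‖R x‖ (1 : ℝ≥0) = ‖R x‖ := max_eq_left (by simpa [hnR] using hx1)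
    have h2 : max ‖Q x‖ δ = ‖Q x‖ := max_eq_left (hnQ x)
    change (max ‖R x‖ (1 : ℝ≥0))⁻¹ • R x - (max ‖Q x‖ δ)⁻¹ • Q x = 0
    rw [h1, h2, hQR, sub_self]
  rw [integral_det_add_fderiv_eq μ hπ hGl measurableSet_ball measure_ball_lt_top.ne hG0]
  refine (setIntegral_congr_ae measurableSet_ball ?_).trans (integral_zero E ℝ)
  filter_upwards [hπ.ae_differentiableAt (μ := μ), hGl.ae_differentiableAt (μ := μ)]
    with x hx hx' hxb
  have hd : HasFDerivAt (fun y => y + (-2 : ℝ) • π y + G y)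
      (1 + (-2 : ℝ) • fderiv ℝ π x + fderiv ℝ G x) x :=
    ((hasFDerivAt_id x).add (hx.hasFDerivAt.const_smul (-2 : ℝ))).add hx'.hasFDerivAt
  refine det_fderiv_eq_zero_of_norm_eq_one hd ?_
  filter_upwards [isOpen_ball.mem_nhds hxb] with y hy
  have hy1 : ‖y‖ ≤ 1 := by simpa using (mem_ball.1 hy).le
  have h1 : max ‖R y‖ (1 : ℝ≥0) = 1 := by
    rw [hnR]
    exact max_eq_right hy1
  have h2 : max ‖Q y‖ δ = ‖Q y‖ := max_eq_left (hnQ y)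
  have h3 : y + (-2 : ℝ) • π y + G y = -(‖Q y‖⁻¹ • Q y) := by
    change y + (-2 : ℝ) • π y + ((max ‖R y‖ (1 : ℝ≥0))⁻¹ • R y - (max ‖Q y‖ δ)⁻¹ • Q y) = _
    rw [h1, h2, inv_one]
    simp only [hR]
    module
  have hQ0 : Q y ≠ 0 := norm_pos_iff.1 ((NNReal.coe_pos.2 hδ0).trans_le (hnQ y))
  rw [h3, norm_neg, norm_smul, norm_inv, norm_norm, inv_mul_cancel₀ (norm_ne_zero_iff.2 hQ0)]

end InnerProduct

end DegreeFormula

section PolyhedralCone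

open Metric Set Filter Topology

variable {d : ℕ}

/-- Variational characterization of the metric projection onto a closed convex set. -/
theorem metricProj_spec {C : Set (Ed d)} (hne : C.Nonempty) (hcl : IsClosed C)
    (hconv : Convex ℝ C) (x : Ed d) :
    metricProj d C x ∈ C ∧
      ∀ w ∈ C, ⟪x - metricProj d C x, w - metricProj d C x⟫ ≤ 0 := by
  obtain ⟨p, hpC, hp⟩ := exists_norm_eq_iInf_of_complete_convex hne hcl.isComplete hconv x
  rw [norm_eq_iInf_iff_real_inner_le_zero hconv hpC] at hp
  have hsq : ∀ z ∈ C, dist x p ^ 2 + dist p z ^ 2 ≤ dist x z ^ 2 := fun z hz => by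
    have h1 := norm_sub_sq_real (x - p) (z - p)
    rw [sub_sub_sub_cancel_right] at h1
    rw [dist_eq_norm, dist_eq_norm, dist_eq_norm, h1, norm_sub_rev p z]
    linarith [hp z hz]
  have hex : ∃! y, y ∈ C ∧ ∀ z ∈ C, dist x y ≤ dist x z := by
    refine ⟨p, ⟨hpC, fun z hz => ?_⟩, fun y hy => ?_⟩
    · exact abs_le_of_sq_le_sq' (by nlinarith [hsq z hz, sq_nonneg (dist p z)]) dist_nonneg |>.2
    · have h1 := hsq y hy.1
      have h2 : dist x y ^ 2 ≤ dist x p ^ 2 := by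
        gcongr
        exact hy.2 p hpC
      have h3 : dist p y ^ 2 = 0 := le_antisymm (by linarith) (sq_nonneg _)
      exact (dist_eq_zero.1 (pow_eq_zero_iff two_ne_zero |>.1 h3)).symm
  have heq : metricProj d C x = p := by
    rw [metricProj, dif_pos hex]
    refine hex.unique hex.choose_spec.1 ⟨hpC, fun z hz => ?_⟩
    exact abs_le_of_sq_le_sq' (by nlinarith [hsq z hz, sq_nonneg (dist p z)]) dist_nonneg |>.2
  rw [heq]
  exact ⟨hpC, hp⟩

theorem lipschitzWith_metricProj {C : Set (Ed d)} (hne : C.Nonempty) (hcl : IsClosed C)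
    (hconv : Convex ℝ C) : LipschitzWith 1 (metricProj d C) := by
  refine LipschitzWith.of_dist_le_mul fun x y => ?_
  obtain ⟨hp, hp'⟩ := metricProj_spec hne hcl hconv x
  obtain ⟨hq, hq'⟩ := metricProj_spec hne hcl hconv y
  set p := metricProj d C x
  set q := metricProj d C y
  have h1 := hp' q hq
  have h2 := hq' p hp
  have h3 : ‖p - q‖ ^ 2 ≤ ⟪x - y, p - q⟫ := by
    have e1 : x - p = (x - y) + (y - q) - (p - q) := by abel
    have e2 : q - p = -(p - q) := by abel
    rw [e1, e2, inner_neg_right, inner_sub_left, inner_add_left,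
      real_inner_self_eq_norm_sq] at h1
    linarith
  have h4 := h3.trans (real_inner_le_norm _ _)
  rw [dist_eq_norm, dist_eq_norm, NNReal.coe_one, one_mul]
  rcases (norm_nonneg (p - q)).eq_or_lt with h | h
  · rw [← h]
    exact norm_nonneg _
  · nlinarith

namespace IsPolyCone

variable {C : Set (Ed d)} (hC : IsPolyCone d C)
include hC

theorem zero_mem : (0 : Ed d) ∈ C := by
  obtain ⟨s, rfl⟩ := hC
  simp

theorem add_mem {x y : Ed d} (hx : x ∈ C) (hy : y ∈ C) : x + y ∈ C := by
  obtain ⟨s, rfl⟩ := hC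
  intro c hc
  rw [inner_add_right]
  exact add_nonpos (hx c hc) (hy c hc)

theorem smul_mem {t : ℝ} (ht : 0 ≤ t) {x : Ed d} (hx : x ∈ C) : t • x ∈ C := by
  obtain ⟨s, rfl⟩ := hC
  intro c hc
  rw [inner_smul_right]
  exact mul_nonpos_of_nonneg_of_nonpos ht (hx c hc)

theorem isClosed : IsClosed C := by
  obtain ⟨s, rfl⟩ := hC
  simp only [ofPred_forall]
  exact isClosed_biInter fun c _ => isClosed_le (by fun_prop) continuous_const

theorem convex : Convex ℝ C := fun _ hx _ hy _ _ ha hb _ =>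
  hC.add_mem (hC.smul_mem ha hx) (hC.smul_mem hb hy)

theorem metricProj_mem (x : Ed d) : metricProj d C x ∈ C :=
  (metricProj_spec ⟨0, hC.zero_mem⟩ hC.isClosed hC.convex x).1

theorem inner_sub_metricProj_self (x : Ed d) :
    ⟪x - metricProj d C x, metricProj d C x⟫ = 0 := by
  obtain ⟨hp, hp'⟩ := metricProj_spec ⟨0, hC.zero_mem⟩ hC.isClosed hC.convex x
  have h1 := hp' 0 hC.zero_mem
  have h2 := hp' _ (hC.add_mem hp hp)
  rw [zero_sub, inner_neg_right] at h1
  rw [add_sub_cancel_right] at h2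
  linarith

theorem inner_sub_metricProj_le (x : Ed d) {w : Ed d} (hw : w ∈ C) :
    ⟪x - metricProj d C x, w⟫ ≤ 0 := by
  have h := (metricProj_spec ⟨0, hC.zero_mem⟩ hC.isClosed hC.convex x).2 w hw
  rwa [inner_sub_right, hC.inner_sub_metricProj_self, sub_zero] at h

theorem lipschitzWith_metricProj : LipschitzWith 1 (metricProj d C) :=
  _root_.lipschitzWith_metricProj ⟨0, hC.zero_mem⟩ hC.isClosed hC.convex

/-- A polyhedral cone that is not a linear subspace contains a nonzero vector having nonnegative
inner product with all its elements. -/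
theorem exists_ne_zero_mem_forall_inner_nonneg
    (hsub : ∀ L : Submodule ℝ (Ed d), (L : Set (Ed d)) ≠ C) :
    ∃ e ∈ C, e ≠ 0 ∧ ∀ y ∈ C, 0 ≤ ⟪y, e⟫ := by
  obtain ⟨v, hv, hv'⟩ : ∃ v ∈ C, -v ∉ C := by
    by_contra! hneg
    refine hsub
      { carrier := C
        add_mem' := hC.add_mem
        zero_mem' := hC.zero_mem
        smul_mem' := fun t x hx => ?_ } rfl
    rcases le_total 0 t with ht | ht
    · exact hC.smul_mem ht hx
    · have := hC.smul_mem (neg_nonneg.2 ht) (hneg x hx)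
      rwa [smul_neg, neg_smul, neg_neg] at this
  refine ⟨metricProj d C (-v) + v, hC.add_mem (hC.metricProj_mem _) hv, fun h => hv' ?_,
    fun y hy => ?_⟩
  · rw [← eq_neg_of_add_eq_zero_left h]
    exact hC.metricProj_mem _
  · have := hC.inner_sub_metricProj_le (-v) hy
    rw [real_inner_comm, ← neg_add', inner_neg_right, add_comm] at this
    linarith

end IsPolyCone

open Classical in
/-- The constraints in `s` that are active at `p`. -/
noncomputable def activeConstraints (s : Finset (Ed d)) (p : Ed d) : Finset (Ed d) :=
  s.filter fun c => ⟪c, p⟫ = 0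

theorem mem_activeConstraints {s : Finset (Ed d)} {p c : Ed d} :
    c ∈ activeConstraints s p ↔ c ∈ s ∧ ⟪c, p⟫ = 0 := by
  simp [activeConstraints]

/-- The linear subspace cut out by a finite set of linear equations. -/
noncomputable def commonKernel (I : Finset (Ed d)) : Submodule ℝ (Ed d) :=
  (Submodule.span ℝ (I : Set (Ed d)))ᗮ

theorem mem_commonKernel {I : Finset (Ed d)} {v : Ed d} :
    v ∈ commonKernel I ↔ ∀ c ∈ I, ⟪c, v⟫ = 0 := by
  rw [commonKernel, Submodule.mem_orthogonal]
  refine ⟨fun h c hc => h c (Submodule.subset_span hc), fun h u hu => ?_⟩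
  induction hu using Submodule.span_induction with
  | mem x hx => exact h x hx
  | zero => exact inner_zero_left _
  | add x y _ _ hx hy => rw [inner_add_left, hx, hy, add_zero]
  | smul a x _ hx => rw [inner_smul_left, hx, mul_zero]

theorem mem_commonKernel_activeConstraints_self (s : Finset (Ed d)) (p : Ed d) :
    p ∈ commonKernel (activeConstraints s p) :=
  mem_commonKernel.2 fun _ hc => (mem_activeConstraints.1 hc).2

section Faces

variable {s : Finset (Ed d)} {C : Set (Ed d)} (hs : C = {x | ∀ c ∈ s, ⟪c, x⟫ ≤ 0}) {p : Ed d}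
include hs

theorem eventually_add_mem_cone (hp : p ∈ C) :
    ∀ᶠ v in 𝓝 (0 : Ed d), v ∈ commonKernel (activeConstraints s p) → p + v ∈ C := by
  subst hs
  have : ∀ᶠ v in 𝓝 (0 : Ed d), ∀ c ∈ s, ⟪c, p⟫ ≠ 0 → ⟪c, p + v⟫ < 0 := by
    refine (eventually_all_finset s).2 fun c hc => ?_
    by_cases h : ⟪c, p⟫ = 0
    · simp [h]
    · have hlt : ⟪c, p + 0⟫ < 0 := by
        rw [add_zero]
        exact lt_of_le_of_ne (hp c hc) h
      have hcont : Continuous fun v : Ed d => ⟪c, p + v⟫ := by fun_prop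
      filter_upwards [hcont.continuousAt.eventually (gt_mem_nhds hlt)] with v hv _ using hv
  filter_upwards [this] with v hv hvW c hc
  by_cases h : ⟪c, p⟫ = 0
  · rw [inner_add_right, h, mem_commonKernel.1 hvW c (mem_activeConstraints.2 ⟨hc, h⟩), add_zero]
  · exact (hv c hc h).le

theorem exists_pos_add_sub_smul_mem_cone (hp : p ∈ C) {v : Ed d}
    (hv : v ∈ commonKernel (activeConstraints s p)) :
    ∃ t : ℝ, 0 < t ∧ p + t • v ∈ C ∧ p + t • (-v) ∈ C := by
  have key : ∀ w ∈ commonKernel (activeConstraints s p), ∀ᶠ t in 𝓝[>] (0 : ℝ), p + t • w ∈ C := by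
    intro w hw
    have hcont : Tendsto (fun t : ℝ => t • w) (𝓝[>] 0) (𝓝 0) := by
      have : Continuous fun t : ℝ => t • w := by fun_prop
      simpa using (this.tendsto 0).mono_left nhdsWithin_le_nhds
    filter_upwards [hcont.eventually (eventually_add_mem_cone hs hp)] with t ht
    exact ht (Submodule.smul_mem _ _ hw)
  obtain ⟨t, ht, h1, h2⟩ := (eventually_mem_nhdsWithin.and ((key v hv).and
    (key (-v) (Submodule.neg_mem _ hv)))).exists
  exact ⟨t, ht, h1, h2⟩

/-- The linear span of a face is cut out by the constraints active at any of its relative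
interior points. -/
theorem span_face_eq_commonKernel {F : Set (Ed d)} (hF : IsFaceOf d C F)
    (hp : p ∈ intrinsicInterior ℝ F) :
    Submodule.span ℝ F = commonKernel (activeConstraints s p) := by
  have hC : IsPolyCone d C := ⟨s, hs⟩
  have hpF : p ∈ F := intrinsicInterior_subset hp
  obtain ⟨a, ha, hFa⟩ := hF
  have hFC : F ⊆ C := hFa ▸ sep_subset _ _
  have h0F : (0 : Ed d) ∈ F := by
    rw [hFa]
    exact ⟨hC.zero_mem, inner_zero_right _⟩
  apply le_antisymm
  · refine Submodule.span_le.2 fun f hf => mem_commonKernel.2 fun c hc => ?_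
    obtain ⟨hcs, hcp⟩ := mem_activeConstraints.1 hc
    have hle : ∀ x ∈ F, ⟪c, x⟫ ≤ 0 := fun x hx => by
      have := hFC hx
      rw [hs] at this
      exact this c hcs
    obtain ⟨y, hy, hyp⟩ := mem_intrinsicInterior.1 hp
    have hmem : ∀ t : ℝ, t • (0 - f) + p ∈ affineSpan ℝ F := fun t =>
      (affineSpan ℝ F).smul_vsub_vadd_mem t (subset_affineSpan ℝ F h0F)
        (subset_affineSpan ℝ F hf) (subset_affineSpan ℝ F hpF)
    have hcont : Continuous fun t : ℝ => (⟨_, hmem t⟩ : affineSpan ℝ F) :=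
      Continuous.subtype_mk (by fun_prop) _
    have hy0 : (⟨_, hmem 0⟩ : affineSpan ℝ F) = y := Subtype.ext (by simp [hyp])
    have hev := (hcont.tendsto 0).eventually (hy0 ▸ mem_interior_iff_mem_nhds.1 hy)
    obtain ⟨t, ht, htF⟩ := ((eventually_mem_nhdsWithin (a := (0 : ℝ)) (s := Ioi 0)).and
      (hev.filter_mono nhdsWithin_le_nhds)).exists
    have h1 := hle _ htF
    rw [inner_add_right, hcp, inner_smul_right, zero_sub, inner_neg_right] at h1
    have h2 := hle f hf
    have ht' : (0 : ℝ) < t := ht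
    nlinarith
  · intro v hv
    obtain ⟨t, ht, h1, h2⟩ := exists_pos_add_sub_smul_mem_cone hs (hFC hpF) hv
    have hap : ⟪a, p⟫ = 0 := by
      rw [hFa] at hpF
      exact hpF.2
    have h1' := ha _ h1
    have h2' := ha _ h2
    rw [smul_neg, inner_add_right, inner_neg_right] at h2'
    rw [inner_add_right] at h1'
    have hF1 : p + t • v ∈ F := by
      rw [hFa]
      refine ⟨h1, ?_⟩
      rw [inner_add_right]
      linarith
    have : v = t⁻¹ • ((p + t • v) - p) := by
      rw [add_sub_cancel_left, inv_smul_smul₀ ht.ne']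
    rw [this]
    exact Submodule.smul_mem _ _ (Submodule.sub_mem _ (Submodule.subset_span hF1)
      (Submodule.subset_span hpF))

/-- Every point of a polyhedral cone lies in the relative interior of a face. -/
theorem exists_face_mem_intrinsicInterior (hp : p ∈ C) :
    ∃ F, IsFaceOf d C F ∧ p ∈ intrinsicInterior ℝ F := by
  set a := ∑ c ∈ activeConstraints s p, c with ha
  have hle : ∀ x ∈ C, ∀ c ∈ activeConstraints s p, ⟪c, x⟫ ≤ 0 := fun x hx c hc => by
    rw [hs] at hx
    exact hx c (mem_activeConstraints.1 hc).1
  have hFW : ∀ x ∈ C, ⟪a, x⟫ = 0 ↔ x ∈ commonKernel (activeConstraints s p) := fun x hx => by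
    rw [mem_commonKernel, ha, sum_inner]
    exact Finset.sum_eq_zero_iff_of_nonpos (hle x hx)
  have hpF : p ∈ {x ∈ C | ⟪a, x⟫ = 0} :=
    ⟨hp, (hFW p hp).2 (mem_commonKernel_activeConstraints_self s p)⟩
  refine ⟨{x ∈ C | ⟪a, x⟫ = 0}, ⟨a, fun x hx => ?_, rfl⟩, ?_⟩
  · rw [ha, sum_inner]
    exact Finset.sum_nonpos (hle x hx)
  · refine mem_intrinsicInterior.2 ⟨⟨p, subset_affineSpan ℝ _ hpF⟩, ?_, rfl⟩
    rw [mem_interior_iff_mem_nhds, nhds_subtype_eq_comap]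
    have hcont : Tendsto (fun y : Ed d => y - p) (𝓝 p) (𝓝 0) := by
      have : Continuous fun y : Ed d => y - p := by fun_prop
      simpa using this.tendsto p
    have hev := (hcont.eventually (eventually_add_mem_cone hs hp)).comap
      ((↑) : affineSpan ℝ {x ∈ C | ⟪a, x⟫ = 0} → Ed d)
    filter_upwards [hev] with y hy
    have hyW : (y : Ed d) ∈ commonKernel (activeConstraints s p) := by
      have hsub : affineSpan ℝ {x ∈ C | ⟪a, x⟫ = 0} ≤
          (commonKernel (activeConstraints s p)).toAffineSubspace :=
        affineSpan_le.2 fun x hx => (hFW x hx.1).1 hx.2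
      exact hsub y.2
    have hyC := hy (Submodule.sub_mem _ hyW (mem_commonKernel_activeConstraints_self s p))
    rw [add_sub_cancel] at hyC
    exact ⟨hyC, (hFW _ hyC).2 hyW⟩

theorem mem_Pik_iff {k : ℕ} {x : Ed d} :
    x ∈ Pik d C k ↔
      Module.finrank ℝ (commonKernel (activeConstraints s (metricProj d C x))) = k := by
  constructor
  · rintro ⟨F, hF, hp, rfl⟩
    rw [setDim, span_face_eq_commonKernel hs hF hp]
  · intro h
    obtain ⟨F, hF, hp⟩ := exists_face_mem_intrinsicInterior hs
      (IsPolyCone.metricProj_mem ⟨s, hs⟩ x)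
    exact ⟨F, hF, hp, by rw [setDim, span_face_eq_commonKernel hs hF hp, h]⟩

theorem metricProj_eq_starProjection (x : Ed d) :
    metricProj d C x =
      (commonKernel (activeConstraints s (metricProj d C x))).starProjection x := by
  have hC : IsPolyCone d C := ⟨s, hs⟩
  refine (Submodule.eq_starProjection_of_mem_of_inner_eq_zero
    (mem_commonKernel_activeConstraints_self s _) fun v hv => ?_).symm
  obtain ⟨t, ht, h1, h2⟩ := exists_pos_add_sub_smul_mem_cone hs (hC.metricProj_mem x) hv
  have h1' := hC.inner_sub_metricProj_le x h1
  have h2' := hC.inner_sub_metricProj_le x h2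
  rw [inner_add_right, hC.inner_sub_metricProj_self, inner_smul_right] at h1' h2'
  rw [inner_neg_right] at h2'
  exact le_antisymm (by nlinarith) (by nlinarith)

/-- Almost everywhere, the derivative of the metric projection onto a polyhedral cone is the
orthogonal projection onto the span of the face containing the projected point. -/
theorem ae_fderiv_metricProj_eq :
    ∀ᵐ x : Ed d, fderiv ℝ (metricProj d C) x =
      (commonKernel (activeConstraints s (metricProj d C x))).starProjection := by
  have hC : IsPolyCone d C := ⟨s, hs⟩
  have hl := hC.lipschitzWith_metricProj
  have key : ∀ I ∈ s.powerset, ∀ᵐ x : Ed d,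
      metricProj d C x = (commonKernel I).starProjection x →
        fderiv ℝ (metricProj d C) x = (commonKernel I).starProjection := by
    intro I _
    set S : Set (Ed d) := {x | metricProj d C x = (commonKernel I).starProjection x} ∩
      {x | DifferentiableAt ℝ (metricProj d C) x} with hS
    have hSm : MeasurableSet S :=
      (isClosed_eq hl.continuous (commonKernel I).starProjection.continuous).measurableSet.inter
        (measurableSet_of_differentiableAt ℝ _)
    have happ : ApproximatesLinearOn (metricProj d C) (commonKernel I).starProjection S 0 := by
      intro x hx y hy
      rw [hx.1, hy.1, map_sub]
      simp
    have := happ.norm_fderiv_sub_le volume hSm (fderiv ℝ (metricProj d C))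
      fun x hx => hx.2.hasFDerivAt.hasFDerivWithinAt
    filter_upwards [(ae_restrict_iff' hSm).1 this, hl.ae_differentiableAt (μ := volume)]
      with x hx hd hxI
    have h0 := hx ⟨hxI, hd⟩
    exact sub_eq_zero.1 (nnnorm_eq_zero.1 (nonpos_iff_eq_zero.1 h0))
  filter_upwards [(eventually_all_finset _).2 key] with x hx
  exact hx _ (Finset.mem_powerset.2 fun c hc => (mem_activeConstraints.1 hc).1)
    (metricProj_eq_starProjection hs x)

theorem measurableSet_Pik (k : ℕ) : MeasurableSet (Pik d C k) := by
  have hl := (IsPolyCone.lipschitzWith_metricProj ⟨s, hs⟩ : LipschitzWith 1 (metricProj d C))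
  have heq : Pik d C k = ⋃ I ∈ s.powerset.filter
      (fun I => Module.finrank ℝ (commonKernel I) = k),
      {x | ∀ c ∈ s, ⟪c, metricProj d C x⟫ = 0 ↔ c ∈ I} := by
    ext x
    rw [mem_Pik_iff hs]
    simp only [mem_iUnion, Finset.mem_filter, Finset.mem_powerset, mem_ofPred_eq, exists_prop]
    constructor
    · intro h
      exact ⟨_, ⟨fun c hc => (mem_activeConstraints.1 hc).1, h⟩, fun c hc => by
        simp [mem_activeConstraints, hc]⟩
    · rintro ⟨I, ⟨hI, hk⟩, hx⟩
      have : activeConstraints s (metricProj d C x) = I := by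
        ext c
        rw [mem_activeConstraints]
        exact ⟨fun h => (hx c h.1).1 h.2, fun h => ⟨hI h, (hx c (hI h)).2 h⟩⟩
      rw [this, hk]
  rw [heq]
  refine Finset.measurableSet_biUnion _ fun I _ => ?_
  simp only [ofPred_forall]
  refine Finset.measurableSet_biInter _ fun c _ => ?_
  have hm : MeasurableSet {x | ⟪c, metricProj d C x⟫ = 0} :=
    (isClosed_eq (continuous_const.inner hl.continuous) continuous_const).measurableSet
  by_cases h : c ∈ I
  · simpa only [h, iff_true] using hm
  · simp only [h, iff_false]
    exact hm.compl

end Faces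

/-- `1 - 2 P_W` has determinant `(-1) ^ dim W`. -/
theorem det_one_sub_two_smul_starProjection (W : Submodule ℝ (Ed d)) :
    (1 + (-2 : ℝ) • W.starProjection).det = (-1) ^ Module.finrank ℝ W := by
  have h := Submodule.det_reflection (K := Wᗮ)
  rw [Submodule.orthogonal_orthogonal] at h
  rw [← h, ContinuousLinearMap.det]
  congr 1
  ext x : 1
  have : Wᗮ.reflection x = -(W.reflection x) := W.reflection_orthogonal_apply x
  simp only [LinearEquiv.coe_coe, LinearIsometryEquiv.coe_toLinearEquiv, this,
    Submodule.reflection_apply, ContinuousLinearMap.coe_coe, add_apply,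
    smul_apply, one_apply_eq_self]
  module

/-- Spherical Gauss–Bonnet: the alternating sum of the spherical intrinsic volumes of a polyhedral
cone that is not a linear subspace vanishes. -/
theorem IsPolyCone.sum_neg_one_pow_mul_sphIntrinsicVol {C : Set (Ed d)} (hC : IsPolyCone d C)
    (hsub : ∀ L : Submodule ℝ (Ed d), (L : Set (Ed d)) ≠ C) :
    ∑ k ∈ Finset.range (d + 1), (-1 : ℝ) ^ k * sphIntrinsicVol d C k = 0 := by
  obtain ⟨e, heC, he, hepos⟩ := hC.exists_ne_zero_mem_forall_inner_nonneg hsub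
  have hzero := integral_det_one_sub_two_smul_fderiv_eq_zero (volume : Measure (Ed d))
    hC.lipschitzWith_metricProj he
    (fun x => by rw [real_inner_comm]; exact hC.inner_sub_metricProj_self x)
    (fun x => by
      have h1 := hepos _ (hC.metricProj_mem x)
      have h2 := hC.inner_sub_metricProj_le x heC
      have h3 : (2 : ℝ) • metricProj d C x - x =
        metricProj d C x - (x - metricProj d C x) := by module
      rw [h3, inner_sub_left]
      linarith)
  obtain ⟨s, hs⟩ := id hC
  have hball : (ball (0 : Ed d) 1 : Set (Ed d)) =ᵐ[volume] closedBall (0 : Ed d) 1 := by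
    rw [← ball_union_sphere]
    exact (union_ae_eq_left_of_ae_eq_empty
      (ae_eq_empty.2 (Measure.addHaar_sphere_of_ne_zero _ _ one_ne_zero))).symm
  have hpt : ∀ᵐ x : Ed d, (1 + (-2 : ℝ) • fderiv ℝ (metricProj d C) x).det =
      ∑ k ∈ Finset.range (d + 1), (Pik d C k).indicator (fun _ => (-1 : ℝ) ^ k) x := by
    filter_upwards [ae_fderiv_metricProj_eq hs] with x hx
    rw [hx, det_one_sub_two_smul_starProjection]
    set n := Module.finrank ℝ (commonKernel (activeConstraints s (metricProj d C x))) with hn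
    have hnd : n ∈ Finset.range (d + 1) := by
      rw [Finset.mem_range, Nat.lt_succ_iff]
      simpa using Submodule.finrank_le (commonKernel (activeConstraints s (metricProj d C x)))
    rw [Finset.sum_eq_single_of_mem n hnd]
    · rw [indicator_of_mem ((mem_Pik_iff hs).2 rfl)]
    · intro k _ hk
      rw [indicator_of_notMem]
      rw [mem_Pik_iff hs]
      exact fun h => hk h.symm
  rw [setIntegral_congr_set hball, integral_congr_ae (ae_restrict_of_ae hpt),
    integral_finsetSum] at hzero
  · have hterm : ∀ k, ∫ x in closedBall (0 : Ed d) 1,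
        (Pik d C k).indicator (fun _ => (-1 : ℝ) ^ k) x =
        (-1) ^ k * (volume (Pik d C k ∩ closedBall (0 : Ed d) 1)).toReal := fun k => by
      rw [integral_indicator (measurableSet_Pik hs k), setIntegral_const, measureReal_def,
        Measure.restrict_apply (measurableSet_Pik hs k), smul_eq_mul, mul_comm]
    simp only [hterm] at hzero
    simp only [sphIntrinsicVol, ← mul_div_assoc]
    rw [← Finset.sum_div, hzero, zero_div]
  · intro k _
    refine IntegrableOn.integrable ?_
    exact (integrableOn_const measure_closedBall_lt_top.ne).indicator (measurableSet_Pik hs k)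

end PolyhedralCone

/-- If no cone of the fan `N` is a linear subspace, then the
alternating sum of the spherical intrinsic volumes of `N` vanishes:
`χ̄_N(-1) = Σ_k (-1)^k v_k(N) = 0`. -/
theorem fan_charPoly_at_neg_one
    (d : ℕ) (N : Set (Set (Ed d))) (hN : IsFan d N)
    (hsub : ∀ C ∈ N, ∀ L : Submodule ℝ (Ed d), (L : Set (Ed d)) ≠ C) :
    ∑ k ∈ Finset.range (d + 1), (-1 : ℝ) ^ k * fanIntrinsicVol d N k = 0 := by
  simp only [fanIntrinsicVol, finsum_mem_eq_finite_toFinset_sum _ hN.1, Finset.mul_sum]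
  rw [Finset.sum_comm]
  refine Finset.sum_eq_zero fun C hC => ?_
  have hCN : C ∈ N := hN.1.mem_toFinset.1 hC
  exact (hN.2.1 C hCN).sum_neg_one_pow_mul_sphIntrinsicVol (hsub C hCN)
end
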